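/- Let m, d ≥ 1, let ω ∈ ℝ^d satisfy ω·ν ≠ 0 for every nonzero ν ∈ ℤ^d, let Γ be a symmetric positive definite real m×m matrix, V : ℝ^m → ℝ real analytic with g = ∇V, f : ℝ^d → ℝ^m (2πℤ)^d-periodic and real analytic with mean f₀, and let c ∈ ℝ^m satisfy g(c) = f₀ with the Hessian of V at c positive definite. Then there exist ε̄ > 0 and ζ̄ > 0 such that for every ε ∈ (0, ε̄) and every ζ ∈ ℝ^m with |ζ| < ζ̄ there exists a real analytic, (2πℤ)^d-periodic function u = u(·, ε, ζ) : ℝ^d → ℝ^m with zero mean satisfying the range equation ε (ω·∇)² u(ψ) + Γ (ω·∇) u(ψ) + ε Π[ g(c + ζ + u(·)) ](ψ) = ε Π[f](ψ) for all ψ ∈ ℝ^d, where Π denotes subtraction of the mean over [0,2π]^d (projection onto zero-mean functions) and (ω·∇) = Σ_j ω_j ∂/∂ψ_j. -/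

import Mathlib

open scoped Real
open Filter

noncomputable section

/-- The mean of a `(2πℤ)^d`-periodic function over the fundamental box `[0,2π]^d`. -/
def boxMean (d m : ℕ) (F : (Fin d → ℝ) → (Fin m → ℝ)) : Fin m → ℝ :=
  ((2 * π)⁻¹ ^ d) • ∫ ψ in Set.univ.pi fun _ : Fin d => Set.Icc (0 : ℝ) (2 * π), F ψ

/-- `(2πℤ)^d`-periodicity. -/
def IsPeriodic2pi (d m : ℕ) (F : (Fin d → ℝ) → (Fin m → ℝ)) : Prop :=
  ∀ (ψ : Fin d → ℝ) (k : Fin d → ℤ), F (fun j => ψ j + 2 * π * k j) = F ψ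

/-- The Hessian matrix of `V : ℝ^m → ℝ` at the point `c`. -/
def hessianMatrix (m : ℕ) (V : (Fin m → ℝ) → ℝ) (c : Fin m → ℝ) :
    Matrix (Fin m) (Fin m) ℝ :=
  Matrix.of fun i j => iteratedFDeriv ℝ 2 V c ![Pi.single i 1, Pi.single j 1]

namespace RangeEq

set_option linter.unusedSectionVars false

open MeasureTheory Topology

section Resolvent

variable {T : Type*} [TopologicalSpace T] [CompactSpace T] [AddCommGroup T]
  [IsTopologicalAddGroup T]
variable {E : Type*} [NormedAddCommGroup E] [NormedSpace ℝ E] [CompleteSpace E]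

/-- Translation operator. -/
def tr (a : T) : C(T, E) →L[ℝ] C(T, E) :=
  LinearMap.mkContinuous
    { toFun := fun U => U.comp ⟨fun x => x + a, by fun_prop⟩
      map_add' := fun _ _ => rfl
      map_smul' := fun _ _ => rfl } 1 (by
    intro U
    rw [one_mul]
    refine (ContinuousMap.norm_le _ (norm_nonneg _)).2 fun x => ?_
    exact U.norm_coe_le_norm _)

@[simp] lemma tr_apply (a : T) (U : C(T, E)) (x : T) : tr a U x = U (x + a) := rfl

/-- Pointwise action of a linear map. -/
def pw {T E F : Type*} [TopologicalSpace T] [CompactSpace T] [NormedAddCommGroup E]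
    [NormedSpace ℝ E] [NormedAddCommGroup F] [NormedSpace ℝ F]
    (L : E →L[ℝ] F) : C(T, E) →L[ℝ] C(T, F) :=
  LinearMap.mkContinuous
    { toFun := fun U => ⟨fun x => L (U x), by fun_prop⟩
      map_add' := fun _ _ => by ext x; simp
      map_smul' := fun _ _ => by ext x; simp } ‖L‖ (by
    intro U
    refine (ContinuousMap.norm_le _ (by positivity)).2 fun x => ?_
    exact (L.le_opNorm _).trans (by gcongr; exact U.norm_coe_le_norm _))

@[simp] lemma pw_apply {T E F : Type*} [TopologicalSpace T] [CompactSpace T]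
    [NormedAddCommGroup E] [NormedSpace ℝ E] [NormedAddCommGroup F] [NormedSpace ℝ F]
    (L : E →L[ℝ] F) (U : C(T, E)) (x : T) : pw L U x = L (U x) := rfl

lemma pw_norm {T E F : Type*} [TopologicalSpace T] [CompactSpace T]
    [NormedAddCommGroup E] [NormedSpace ℝ E] [NormedAddCommGroup F] [NormedSpace ℝ F]
    (L : E →L[ℝ] F) : ‖(pw L : C(T, E) →L[ℝ] C(T, F))‖ ≤ ‖L‖ :=
  LinearMap.mkContinuous_norm_le _ (norm_nonneg _) _

lemma pw_norm_le {T E F : Type*} [TopologicalSpace T] [CompactSpace T]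
    [NormedAddCommGroup E] [NormedSpace ℝ E] [NormedAddCommGroup F] [NormedSpace ℝ F]
    (L : E →L[ℝ] F) (U : C(T, E)) : ‖pw L U‖ ≤ ‖L‖ * ‖U‖ :=
  (ContinuousLinearMap.le_opNorm _ _).trans (by gcongr; exact pw_norm L)

/-- The semigroup generated by `-M`. -/
def Sg (M : E →L[ℝ] E) (t : ℝ) : E →L[ℝ] E := NormedSpace.exp (t • (-M))

lemma Sg_hasDerivAt (M : E →L[ℝ] E) (t : ℝ) : HasDerivAt (Sg M) (-M * Sg M t) t :=
  hasDerivAt_exp_smul_const' (-M) t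

lemma Sg_hasDerivAt' (M : E →L[ℝ] E) (t : ℝ) : HasDerivAt (Sg M) (Sg M t * -M) t :=
  hasDerivAt_exp_smul_const (-M) t

lemma Sg_continuous (M : E →L[ℝ] E) : Continuous (Sg M) :=
  continuous_iff_continuousAt.2 fun t => (Sg_hasDerivAt M t).continuousAt

lemma Sg_add (M : E →L[ℝ] E) (s t : ℝ) : Sg M (s + t) = Sg M s * Sg M t := by
  unfold Sg
  let _ : NormedAlgebra ℚ (E →L[ℝ] E) := NormedAlgebra.restrictScalars ℚ ℝ _
  rw [add_smul, NormedSpace.exp_add_of_commute]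
  exact ((Commute.refl (-M)).smul_left s).smul_right t

@[simp] lemma Sg_zero (M : E →L[ℝ] E) : Sg M 0 = 1 := by simp [Sg]

lemma Sg_comm (M : E →L[ℝ] E) (t : ℝ) (v : E) : Sg M t (M v) = M (Sg M t v) := by
  have h : Commute (NormedSpace.exp (t • (-M))) M :=
    (((Commute.refl M).neg_left).smul_left t).exp_left
  have := h.eq
  exact congrArg (fun L : E →L[ℝ] E => L v) this

lemma Sg_smul (M : E →L[ℝ] E) (a t : ℝ) : Sg (a • M) t = Sg M (a * t) := by
  simp [Sg, smul_smul, mul_comm]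

variable (θ : ℝ →+ T) (hθ : Continuous θ)

/-- The integrand of the resolvent. -/
def kern (M : E →L[ℝ] E) (h : C(T, E)) : C(ℝ, C(T, E)) :=
  ContinuousMap.curry ⟨fun p : ℝ × T => Sg M p.1 (h (p.2 - θ p.1)), by
    have := Sg_continuous M
    fun_prop⟩

@[simp] lemma kern_apply (M : E →L[ℝ] E) (h : C(T, E)) (t : ℝ) (x : T) :
    kern θ hθ M h t x = Sg M t (h (x - θ t)) := rfl

lemma kern_eq (M : E →L[ℝ] E) (h : C(T, E)) (t : ℝ) :
    kern θ hθ M h t = pw (Sg M t) (tr (-θ t) h) := by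
  ext x
  simp [sub_eq_add_neg]

/-- exponential decay of the semigroup -/
def Decay (M : E →L[ℝ] E) (C l : ℝ) : Prop := ∀ t, 0 ≤ t → ‖Sg M t‖ ≤ C * Real.exp (-l * t)

variable {M : E →L[ℝ] E} {C l : ℝ}

lemma Decay.nonneg (hM : Decay M C l) : 0 ≤ C := by
  have := (norm_nonneg _).trans (hM 0 le_rfl)
  simpa using this

lemma kern_norm_le (hM : Decay M C l) (h : C(T, E)) {t : ℝ} (ht : 0 ≤ t) :
    ‖kern θ hθ M h t‖ ≤ C * Real.exp (-l * t) * ‖h‖ := by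
  have := hM.nonneg
  refine (ContinuousMap.norm_le _ (by positivity)).2 fun x => ?_
  rw [kern_apply]
  refine (ContinuousLinearMap.le_opNorm _ _).trans ?_
  gcongr
  · exact hM t ht
  · exact h.norm_coe_le_norm _

lemma decay_integrable (hl : 0 < l) (C K : ℝ) :
    IntegrableOn (fun t => C * Real.exp (-l * t) * K) (Set.Ioi 0) :=
  ((integrableOn_exp_mul_Ioi (by linarith) 0).const_mul C).mul_const K

lemma kern_integrable (hM : Decay M C l) (hl : 0 < l) (h : C(T, E)) :
    IntegrableOn (kern θ hθ M h) (Set.Ioi 0) := by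
  refine Integrable.mono' (decay_integrable hl C ‖h‖) ?_ ?_
  · exact (kern θ hθ M h).continuous.aestronglyMeasurable
  · filter_upwards [ae_restrict_mem measurableSet_Ioi] with t ht
    exact kern_norm_le θ hθ hM h (le_of_lt ht)

/-- The resolvent `(∂ + M)⁻¹`. -/
def Rop (M : E →L[ℝ] E) {C l : ℝ} (hM : Decay M C l) (hl : 0 < l) : C(T, E) →L[ℝ] C(T, E) :=
  LinearMap.mkContinuous
    { toFun := fun h => ∫ t in Set.Ioi (0:ℝ), kern θ hθ M h t
      map_add' := fun h k => by
        rw [← integral_add (kern_integrable θ hθ hM hl h) (kern_integrable θ hθ hM hl k)]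
        congr 1
        ext t x
        simp
      map_smul' := fun a h => by
        rw [RingHom.id_apply, ← integral_smul]
        congr 1
        ext t x
        simp } (C / l) (by
    intro h
    refine (norm_integral_le_of_norm_le (decay_integrable hl C ‖h‖) ?_).trans (le_of_eq ?_)
    · filter_upwards [ae_restrict_mem measurableSet_Ioi] with t ht
      exact kern_norm_le θ hθ hM h (le_of_lt ht)
    · rw [integral_mul_const, integral_const_mul, integral_exp_mul_Ioi (by linarith)]
      simp only [mul_zero, Real.exp_zero]
      field_simp)

variable (hM : Decay M C l) (hl : 0 < l)

lemma Rop_def (h : C(T, E)) : Rop θ hθ M hM hl h = ∫ t in Set.Ioi (0:ℝ), kern θ hθ M h t := rfl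

lemma Rop_norm : ‖(Rop θ hθ M hM hl : C(T, E) →L[ℝ] C(T, E))‖ ≤ C / l :=
  LinearMap.mkContinuous_norm_le _ (by have := hM.nonneg; positivity) _

lemma Rop_clm {Y : Type*} [NormedAddCommGroup Y] [NormedSpace ℝ Y] [CompleteSpace Y]
    (L : C(T, E) →L[ℝ] Y) (h : C(T, E)) :
    L (Rop θ hθ M hM hl h) = ∫ t in Set.Ioi (0:ℝ), L (kern θ hθ M h t) :=
  (L.integral_comp_comm (kern_integrable θ hθ hM hl h)).symm

/-- evaluation -/
def ev (x : T) : C(T, E) →L[ℝ] E := ContinuousMap.evalCLM ℝ x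

lemma Rop_apply (h : C(T, E)) (x : T) :
    Rop θ hθ M hM hl h x = ∫ t in Set.Ioi (0:ℝ), Sg M t (h (x - θ t)) :=
  Rop_clm θ hθ hM hl (ev x) h

lemma Rop_tr (a : T) (h : C(T, E)) :
    tr a (Rop θ hθ M hM hl h) = Rop θ hθ M hM hl (tr a h) := by
  ext x
  rw [tr_apply, Rop_apply, Rop_apply]
  congr 1
  ext t
  simp [sub_add_eq_add_sub]

lemma Rop_pw (h : C(T, E)) :
    pw M (Rop θ hθ M hM hl h) = Rop θ hθ M hM hl (pw M h) := by
  rw [Rop_clm, Rop_def]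
  congr 1
  ext t x
  simp [Sg_comm]

lemma Rop_mean (μ : C(T, E) →L[ℝ] E)
    (hμ : ∀ (L : E →L[ℝ] E) a h, μ (pw L (tr a h)) = L (μ h)) (h : C(T, E)) (h0 : μ h = 0) :
    μ (Rop θ hθ M hM hl h) = 0 := by
  rw [Rop_clm]
  simp [kern_eq, hμ, h0]

/-- `G` is the derivative of `F` along the flow. -/
def HD {E : Type*} [NormedAddCommGroup E] [NormedSpace ℝ E] (θ : ℝ →+ T) (F G : C(T, E)) : Prop :=
  ∀ x s, HasDerivAt (fun s => F (x + θ s)) (G (x + θ s)) s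

lemma integrable_apply (hθ : Continuous θ) (hM : Decay M C l) (hl : 0 < l) (h : C(T, E)) (x : T) :
    IntegrableOn (fun t => Sg M t (h (x - θ t))) (Set.Ioi 0) :=
  (ev x : C(T, E) →L[ℝ] E).integrable_comp (kern_integrable θ hθ hM hl h)

lemma Rop_right (h : C(T, E)) :
    HD θ (Rop θ hθ M hM hl h) (h - pw M (Rop θ hθ M hM hl h)) := by
  intro x s
  set k : ℝ → E := fun t => Sg M t (h (x - θ t)) with hk
  have hkc : Continuous k := by
    have := Sg_continuous M
    fun_prop
  have hki : IntegrableOn k (Set.Ioi 0) := integrable_apply θ hθ hM hl h x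
  have hform : ∀ s, Rop θ hθ M hM hl h (x + θ s)
      = Sg M s ((∫ t in (-s)..0, k t) + ∫ t in Set.Ioi 0, k t) := by
    intro s
    have hki' : IntegrableOn k (Set.Ioi (-s)) := by
      rcases le_total (-s) 0 with h0 | h0
      · rw [← Set.Ioc_union_Ioi_eq_Ioi h0]
        exact (hkc.integrableOn_Ioc).union hki
      · exact hki.mono_set (Set.Ioi_subset_Ioi h0)
    rw [intervalIntegral.integral_interval_add_Ioi hki' hki, Rop_apply,
      ← ContinuousLinearMap.integral_comp_comm _ hki']
    have := (measurePreserving_add_right volume (s)).setIntegral_preimage_emb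
      (measurableEmbedding_addRight s) (fun t => Sg M t (h (x + θ s - θ t))) (Set.Ioi 0)
    rw [← this]
    have h1 : (fun x => x + s) ⁻¹' Set.Ioi 0 = Set.Ioi (-s) := by
      ext y; simp [neg_lt_iff_pos_add]
    rw [h1]
    congr 1
    ext t
    rw [add_comm t s, Sg_add, map_add]
    have h2 : x + θ s - (θ s + θ t) = x - θ t := by abel
    simp [hk, h2]
  have hd : HasDerivAt (fun s => Sg M s ((∫ t in (-s)..0, k t) + ∫ t in Set.Ioi 0, k t))
      ((-M * Sg M s) ((∫ t in (-s)..0, k t) + ∫ t in Set.Ioi 0, k t) + Sg M s (k (-s))) s := by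
    refine (Sg_hasDerivAt M s).clm_apply ?_
    refine HasDerivAt.add_const _ ?_
    have h1 : HasDerivAt (fun u => ∫ t in u..0, k t) (-k (-s)) (-s) :=
      intervalIntegral.integral_hasDerivAt_left (hkc.intervalIntegrable _ _)
        (hkc.stronglyMeasurableAtFilter _ _) hkc.continuousAt
    have := h1.scomp s (hasDerivAt_neg s)
    simpa [Function.comp_def] using this
  rw [funext hform]
  refine hd.congr_deriv ?_
  rw [ContinuousMap.sub_apply]
  have e1 : Sg M s (k (-s)) = h (x + θ s) := by
    simp only [hk]
    rw [← mul_apply_eq_comp, ← Sg_add]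
    simp
  rw [e1]
  have e2 : pw M (Rop θ hθ M hM hl h) (x + θ s) = M (Rop θ hθ M hM hl h (x + θ s)) := rfl
  rw [e2, hform]
  simp
  abel

lemma Rop_left {F F' : C(T, E)} (hF : HD θ F F') :
    Rop θ hθ M hM hl (F' + pw M F) = F := by
  ext x
  rw [Rop_apply]
  have hC := hM.nonneg
  have hd : ∀ t, HasDerivAt (fun t => Sg M t (F (x - θ t)))
      (-(Sg M t ((F' + pw M F) (x - θ t)))) t := by
    intro t
    have h1 : HasDerivAt (fun t => F (x - θ t)) (-F' (x - θ t)) t := by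
      have := (hF x (-t)).scomp t (hasDerivAt_neg t)
      simpa [Function.comp_def, sub_eq_add_neg] using this
    refine ((Sg_hasDerivAt' M t).clm_apply h1).congr_deriv ?_
    simp [add_comm]
  have ht : Tendsto (fun t => Sg M t (F (x - θ t))) atTop (𝓝 0) := by
    have hb : Tendsto (fun t => C * Real.exp (-l * t) * ‖F‖) atTop (𝓝 0) := by
      have : Tendsto (fun t => Real.exp (-l * t)) atTop (𝓝 0) := by
        refine Real.tendsto_exp_atBot.comp ?_
        exact tendsto_id.const_mul_atTop_of_neg (by linarith)
      simpa using (this.const_mul C).mul_const ‖F‖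
    refine squeeze_zero_norm' ?_ hb
    filter_upwards [eventually_ge_atTop 0] with t ht
    refine (ContinuousLinearMap.le_opNorm _ _).trans ?_
    gcongr
    · exact hM t ht
    · exact F.norm_coe_le_norm _
  have := integral_Ioi_of_hasDerivAt_of_tendsto' (a := 0) (fun t _ => hd t)
    (integrable_apply θ hθ hM hl (F' + pw M F) x).neg ht
  rw [integral_neg] at this
  rw [neg_eq_iff_eq_neg] at this
  rw [this]
  simp

/-- The resolvent commutes with the derivative along the flow. -/
lemma Rop_HD {F F' : C(T, E)} (hF : HD θ F F') :
    HD θ (Rop θ hθ M hM hl F) (Rop θ hθ M hM hl F') := by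
  have h1 := Rop_right θ hθ hM hl F
  have h2 := Rop_left θ hθ hM hl hF
  rw [map_add, ← Rop_pw] at h2
  rwa [sub_eq_of_eq_add h2.symm] at h1

end Resolvent

end RangeEq

namespace RangeEq

set_option linter.unusedSectionVars false

open MeasureTheory Topology
open scoped NNReal ENNReal

section Superposition

variable {T : Type*} [TopologicalSpace T] [CompactSpace T]
variable {F : Type*} [NormedAddCommGroup F] [NormedSpace ℝ F]
variable {E : Type*} [NormedAddCommGroup E] [NormedSpace ℝ E] [CompleteSpace E]

/-- Constant functions. -/
def cst {T F : Type*} [TopologicalSpace T] [CompactSpace T] [NormedAddCommGroup F]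
    [NormedSpace ℝ F] : F →L[ℝ] C(T, F) :=
  LinearMap.mkContinuous
    { toFun := fun v => ContinuousMap.const T v
      map_add' := fun _ _ => rfl
      map_smul' := fun _ _ => rfl } 1 (by
    intro v
    rw [one_mul]
    exact (ContinuousMap.norm_le _ (norm_nonneg _)).2 fun x => le_rfl)

@[simp] lemma cst_apply (v : F) (x : T) : (cst v : C(T, F)) x = v := rfl

lemma cst_norm_le (v : F) : ‖(cst v : C(T, F))‖ ≤ ‖v‖ :=
  (ContinuousMap.norm_le _ (norm_nonneg _)).2 fun _ => le_rfl

/-- The power series of a superposition operator. -/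
def supSeries (q : ∀ n : ℕ, C(T, F [×n]→L[ℝ] E)) : FormalMultilinearSeries ℝ C(T, F) C(T, E) :=
  fun n => MultilinearMap.mkContinuous
    { toFun := fun U => ⟨fun x => q n x (fun i => U i x), by fun_prop⟩
      map_update_add' := fun U i a b => by
        ext x
        have h : ∀ c : C(T, F), (fun j => Function.update U i c j x)
            = Function.update (fun j => U j x) i (c x) := by
          intro c; ext j
          by_cases hj : j = i
          · subst hj; simp
          · simp [hj]
        simp only [ContinuousMap.coe_mk, ContinuousMap.add_apply]
        rw [h, h, h, ContinuousMap.add_apply, ContinuousMultilinearMap.map_update_add]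
      map_update_smul' := fun U i a b => by
        ext x
        have h : ∀ c : C(T, F), (fun j => Function.update U i c j x)
            = Function.update (fun j => U j x) i (c x) := by
          intro c; ext j
          by_cases hj : j = i
          · subst hj; simp
          · simp [hj]
        simp only [ContinuousMap.coe_mk, ContinuousMap.smul_apply]
        rw [h, h, ContinuousMap.smul_apply, ContinuousMultilinearMap.map_update_smul] }
    ‖q n‖ (by
      intro U
      refine (ContinuousMap.norm_le _ (by positivity)).2 fun x => ?_
      refine (ContinuousMultilinearMap.le_opNorm _ _).trans ?_
      gcongr
      · exact (q n).norm_coe_le_norm x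
      · exact (U _).norm_coe_le_norm x)

lemma supSeries_norm (q : ∀ n : ℕ, C(T, F [×n]→L[ℝ] E)) (n : ℕ) :
    ‖supSeries q n‖ ≤ ‖q n‖ :=
  MultilinearMap.mkContinuous_norm_le _ (norm_nonneg (q n)) _

lemma supSeries_apply (q : ∀ n : ℕ, C(T, F [×n]→L[ℝ] E)) (n : ℕ) (U : Fin n → C(T, F)) (x : T) :
    supSeries q n U x = q n x (fun i => U i x) := rfl

lemma sup_hasFPowerSeries (q : ∀ n : ℕ, C(T, F [×n]→L[ℝ] E)) (r : ℝ≥0) (hr : 0 < r) (K : ℝ)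
    (hK : ∀ n, ‖q n‖ * (r : ℝ) ^ n ≤ K) (G : C(T, F) → C(T, E))
    (hG : ∀ U : C(T, F), ‖U‖ < r → ∀ x, HasSum (fun n => q n x (fun _ => U x)) (G U x)) :
    HasFPowerSeriesOnBall G (supSeries q) 0 r := by
  have hrad : (r : ℝ≥0∞) ≤ (supSeries q).radius := by
    refine FormalMultilinearSeries.le_radius_of_bound _ K fun n => ?_
    exact (mul_le_mul_of_nonneg_right (supSeries_norm q n) (by positivity)).trans (hK n)
  refine ⟨hrad, by exact_mod_cast hr, ?_⟩
  intro U hU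
  have hs := (supSeries q).summable (Metric.eball_subset_eball hrad hU)
  have hU' : ‖U‖ < r := by
    rw [mem_eball_zero_iff] at hU
    exact_mod_cast hU
  have : G (0 + U) = ∑' n, supSeries q n (fun _ => U) := by
    ext x
    rw [zero_add]
    have h1 := hs.hasSum.mapL (ContinuousMap.evalCLM ℝ x : C(T, E) →L[ℝ] E)
    exact (hG U hU' x).unique h1
  rw [this]
  exact hs.hasSum

/-- post-composition with a function -/
def post (G : F → E) (hG : Continuous G) (U : C(T, F)) : C(T, E) := ⟨fun x => G (U x), by fun_prop⟩

lemma post_analytic (g : E → E) (hg : Continuous g) (c : E) (hga : AnalyticAt ℝ g c) :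
    ∃ p : FormalMultilinearSeries ℝ C(T, E) C(T, E), ∃ r : ℝ≥0∞,
      HasFPowerSeriesOnBall (post (T := T) (fun v => g (c + v)) (by fun_prop)) p 0 r ∧
      ∀ U x, p 1 (fun _ => U) x = fderiv ℝ g c (U x) := by
  obtain ⟨p, R, hp⟩ := hga
  obtain ⟨r, hr0, hrR⟩ := ENNReal.lt_iff_exists_nnreal_btwn.1 hp.r_pos
  have hr0' : 0 < r := by exact_mod_cast hr0
  obtain ⟨K, hK0, hK⟩ := p.norm_mul_pow_le_of_lt_radius (hrR.trans_le hp.r_le)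
  refine ⟨supSeries (fun n => ContinuousMap.const T (p n)), r,
    sup_hasFPowerSeries _ r hr0' K ?_ _ ?_, ?_⟩
  · intro n
    refine le_trans ?_ (hK n)
    gcongr
    exact (ContinuousMap.norm_le _ (norm_nonneg _)).2 fun x => le_rfl
  · intro U hU x
    refine hp.hasSum ?_
    rw [mem_eball_zero_iff]
    refine lt_trans ?_ hrR
    have := (U.norm_coe_le_norm x).trans_lt hU
    exact_mod_cast this
  · intro U x
    rw [supSeries_apply, hp.hasFPowerSeriesAt.fderiv_eq]
    simp only [ContinuousMap.const_apply, continuousMultilinearCurryFin1_apply]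
    congr 1

lemma analytic_local (f : F → E) (x : F) (hf : AnalyticAt ℝ f x) :
    ∃ s ∈ 𝓝 x, ∃ r : ℝ≥0, 0 < r ∧ ∃ K : ℝ, ∀ y ∈ s,
      (∀ n : ℕ, ‖((n.factorial : ℝ)⁻¹ • iteratedFDeriv ℝ n f y)‖ * (r : ℝ) ^ n ≤ K) ∧
      ∀ v : F, ‖v‖ < r →
        HasSum (fun n : ℕ => ((n.factorial : ℝ)⁻¹ • iteratedFDeriv ℝ n f y) (fun _ => v))
          (f (y + v)) := by
  obtain ⟨p, R, hp⟩ := hf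
  obtain ⟨r', hr0, hrR⟩ := ENNReal.lt_iff_exists_nnreal_btwn.1 hp.r_pos
  have hr0' : 0 < r' := by exact_mod_cast hr0
  set r := r' / 2 with hr
  have hrr : r + r = r' := add_halves r'
  have hrpos : 0 < r := half_pos hr0'
  have hsum : (r + r : ℝ≥0∞) < p.radius := by
    refine lt_of_eq_of_lt ?_ (hrR.trans_le hp.r_le)
    rw [← hrr]; push_cast; rfl
  have hS := p.changeOriginSeries_summable_aux₁ hsum
  have hS2 := (NNReal.summable_sigma.1 hS)
  refine ⟨Metric.ball x r, Metric.ball_mem_nhds x hrpos, r, hrpos, 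
    ((∑' s : Σ k l : ℕ, { s : Finset (Fin (k + l)) // s.card = l },
      ‖p (s.1 + s.2.1)‖₊ * r ^ s.2.1 * r ^ s.1 : ℝ≥0) : ℝ), fun y hy => ?_⟩
  have hyn : ‖y - x‖₊ < r := by
    rw [mem_ball_iff_norm] at hy
    exact_mod_cast hy
  have hyr : (‖y - x‖₊ : ℝ≥0∞) < r := by exact_mod_cast hyn
  have hrr' : (r : ℝ≥0∞) ≤ r' := by rw [← hrr]; push_cast; exact le_self_add
  have hyR : (‖y - x‖₊ : ℝ≥0∞) < R := hyr.trans (hrr'.trans_lt hrR)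
  have hq := hp.changeOrigin hyR
  rw [add_sub_cancel] at hq
  constructor
  · intro n
    have h1 : ‖iteratedFDeriv ℝ n f y‖ ≤ n.factorial * ‖p.changeOrigin (y - x) n‖ := by
      refine ContinuousMultilinearMap.opNorm_le_bound (by positivity) fun v => ?_
      rw [hq.iteratedFDeriv_eq_sum_of_completeSpace]
      refine (norm_sum_le _ _).trans ?_
      refine (Finset.sum_le_card_nsmul _ _ (‖p.changeOrigin (y - x) n‖ * ∏ i, ‖v i‖) ?_).trans ?_
      · intro σ _
        refine (ContinuousMultilinearMap.le_opNorm _ _).trans (le_of_eq ?_)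
        congr 1
        exact Equiv.prod_comp σ (fun i => ‖v i‖)
      · simp [Fintype.card_perm, mul_assoc]
    have h2 : ‖p.changeOrigin (y - x) n‖₊ * r ^ n ≤
        ∑' s : Σ k l : ℕ, { s : Finset (Fin (k + l)) // s.card = l },
          ‖p (s.1 + s.2.1)‖₊ * r ^ s.2.1 * r ^ s.1 := by
      have hlt : (‖y - x‖₊ : ℝ≥0∞) < p.radius := hyR.trans_le hp.r_le
      calc ‖p.changeOrigin (y - x) n‖₊ * r ^ n
          ≤ (∑' s : Σ l : ℕ, { s : Finset (Fin (n + l)) // s.card = l },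
              ‖p (n + s.1)‖₊ * ‖y - x‖₊ ^ s.1) * r ^ n := by
            gcongr; exact p.nnnorm_changeOrigin_le n hlt
        _ = ∑' s : Σ l : ℕ, { s : Finset (Fin (n + l)) // s.card = l },
              ‖p (n + s.1)‖₊ * ‖y - x‖₊ ^ s.1 * r ^ n := by rw [NNReal.tsum_mul_right]
        _ ≤ ∑' s : Σ l : ℕ, { s : Finset (Fin (n + l)) // s.card = l },
              ‖p (n + s.1)‖₊ * r ^ s.1 * r ^ n := by
            have hs1 := hS2.1 n
            refine Summable.tsum_le_tsum (fun s => ?_) (NNReal.summable_of_le (fun s => ?_) hs1) hs1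
            · gcongr
            · dsimp only; gcongr
        _ ≤ _ := by
            rw [hS.tsum_sigma' (fun k => hS2.1 k)]
            exact hS2.2.le_tsum n (fun _ _ => zero_le)
    have h2' : ‖p.changeOrigin (y - x) n‖ * (r : ℝ) ^ n ≤ _ := NNReal.coe_le_coe.2 h2
    refine le_trans ?_ h2'
    gcongr
    rw [norm_smul, norm_inv, Real.norm_natCast, inv_mul_le_iff₀ (by positivity)]
    exact h1
  · intro v hv
    refine hq.hasSum_iteratedFDeriv ?_
    rw [mem_eball_zero_iff]
    have hv' : (‖v‖₊ : ℝ≥0∞) < r := by exact_mod_cast hv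
    rw [lt_tsub_iff_right]
    refine lt_of_lt_of_le (ENNReal.add_lt_add hv' hyr) ?_
    refine le_trans (le_of_eq ?_) hrR.le
    rw [← hrr]; push_cast; rfl

end Superposition

section Translation

variable {T : Type*} [TopologicalSpace T] [CompactSpace T] [AddCommGroup T]
  [IsTopologicalAddGroup T]
variable {F : Type*} [NormedAddCommGroup F] [NormedSpace ℝ F]
variable {E : Type*} [NormedAddCommGroup E] [NormedSpace ℝ E] [CompleteSpace E]

lemma tr_analytic (φ : F →+ T) (hφ : IsOpenQuotientMap φ) (U : C(T, E))
    (hU : AnalyticOnNhd ℝ (fun y => U (φ y)) Set.univ) :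
    AnalyticAt ℝ (fun ψ : F => tr (φ ψ) U) 0 := by
  set f : F → E := fun y => U (φ y) with hf
  have hφc : Continuous φ := hφ.continuous
  have key : ∃ r : ℝ≥0, 0 < r ∧ ∃ K : ℝ, ∀ y, φ y ∈ (Set.univ : Set T) →
      (∀ n : ℕ, ‖((n.factorial : ℝ)⁻¹ • iteratedFDeriv ℝ n f y)‖ * (r : ℝ) ^ n ≤ K) ∧
      ∀ v : F, ‖v‖ < r →
        HasSum (fun n : ℕ => ((n.factorial : ℝ)⁻¹ • iteratedFDeriv ℝ n f y) (fun _ => v))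
          (f (y + v)) := by
    refine isCompact_univ.induction_on (p := fun s : Set T => ∃ r : ℝ≥0, 0 < r ∧ ∃ K : ℝ, ∀ y,
      φ y ∈ s →
      (∀ n : ℕ, ‖((n.factorial : ℝ)⁻¹ • iteratedFDeriv ℝ n f y)‖ * (r : ℝ) ^ n ≤ K) ∧
      ∀ v : F, ‖v‖ < r →
        HasSum (fun n : ℕ => ((n.factorial : ℝ)⁻¹ • iteratedFDeriv ℝ n f y) (fun _ => v))
          (f (y + v))) ?_ ?_ ?_ ?_
    · exact ⟨1, one_pos, 0, fun y hy => hy.elim⟩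
    · rintro s t hst ⟨r, hr, K, h⟩
      exact ⟨r, hr, K, fun y hy => h y (hst hy)⟩
    · rintro s t ⟨r, hr, K, h⟩ ⟨r', hr', K', h'⟩
      refine ⟨min r r', lt_min hr hr', max K K', fun y hy => ⟨fun n => ?_, fun v hv => ?_⟩⟩
      · rcases hy with hy | hy
        · refine le_trans ?_ (((h y hy).1 n).trans (le_max_left _ _))
          gcongr; exact min_le_left _ _
        · refine le_trans ?_ (((h' y hy).1 n).trans (le_max_right _ _))
          gcongr; exact min_le_right _ _
      · rcases hy with hy | hy
        · exact (h y hy).2 v (hv.trans_le (by exact_mod_cast min_le_left _ _))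
        · exact (h' y hy).2 v (hv.trans_le (by exact_mod_cast min_le_right _ _))
    · intro a _
      obtain ⟨x, rfl⟩ := hφ.surjective a
      obtain ⟨s, hs, r, hr, K, h⟩ := analytic_local f x (hU x (Set.mem_univ _))
      refine ⟨φ '' s, mem_nhdsWithin_of_mem_nhds (hφ.isOpenMap.image_mem_nhds hs), r, hr, K, ?_⟩
      rintro y ⟨z, hz, hzy⟩
      have hper : (fun w => f (w + (y - z))) = f := by
        ext w; simp [hf, hzy]
      have hD : ∀ n, iteratedFDeriv ℝ n f y = iteratedFDeriv ℝ n f z := by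
        intro n
        conv_rhs => rw [← hper]
        rw [iteratedFDeriv_comp_add_right]
        simp
      have hv : ∀ v, f (y + v) = f (z + v) := by intro v; simp [hf, hzy]
      simp only [hD, hv]
      exact h z hz
  obtain ⟨r, hr, K, hK⟩ := key
  have hK := fun y => hK y (Set.mem_univ _)
  have hcd : ContDiff ℝ ⊤ f := hU.contDiff.of_le le_top
  have hlift : ∀ n : ℕ, ∃ Q : C(T, F [×n]→L[ℝ] E), ∀ y,
      Q (φ y) = (n.factorial : ℝ)⁻¹ • iteratedFDeriv ℝ n f y := by
    intro n
    have hc : Continuous fun y => (n.factorial : ℝ)⁻¹ • iteratedFDeriv ℝ n f y := by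
      have h := hcd.continuous_iteratedFDeriv (m := n) le_top
      exact Continuous.const_smul (g := fun y => iteratedFDeriv ℝ n f y) h ((n.factorial : ℝ)⁻¹)
    have hs := hφ.isQuotientMap.surjective
    let s := Function.surjInv hs
    have hfac : ∀ y, (n.factorial : ℝ)⁻¹ • iteratedFDeriv ℝ n f (s (φ y))
        = (n.factorial : ℝ)⁻¹ • iteratedFDeriv ℝ n f y := by
      intro y
      have hzy : φ (s (φ y)) = φ y := Function.surjInv_eq hs _
      have hper : (fun w => f (w + (s (φ y) - y))) = f := by
        ext w; simp [hf, hzy]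
      congr 1
      conv_rhs => rw [← hper]
      rw [iteratedFDeriv_comp_add_right]
      simp
    refine ⟨⟨fun a => (n.factorial : ℝ)⁻¹ • iteratedFDeriv ℝ n f (s a), ?_⟩, hfac⟩
    rw [hφ.isQuotientMap.continuous_iff]
    exact hc.congr fun y => (hfac y).symm
  choose Q hQ using hlift
  let G : C(T, F) → C(T, E) := fun W => ⟨fun x => U (x + φ (W x)), by fun_prop⟩
  have hG : HasFPowerSeriesOnBall G (supSeries Q) 0 r := by
    refine sup_hasFPowerSeries Q r hr K ?_ G ?_
    · intro n
      have hK0 : 0 ≤ K := le_trans (by positivity) ((hK 0).1 n)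
      rw [← le_div_iff₀ (by positivity)]
      refine (ContinuousMap.norm_le _ (by positivity)).2 fun x => ?_
      obtain ⟨y, rfl⟩ := hφ.surjective x
      rw [hQ, le_div_iff₀ (by positivity)]
      exact (hK y).1 n
    · intro W hW x
      obtain ⟨y, rfl⟩ := hφ.surjective x
      have := (hK y).2 (W (φ y)) ((W.norm_coe_le_norm _).trans_lt hW)
      simp only [hQ]
      simpa [G, hf] using this
  have hA : AnalyticAt ℝ G (cst (0 : F)) := by
    rw [map_zero]; exact hG.analyticAt
  exact hA.comp ((cst : F →L[ℝ] C(T, F)).analyticAt 0)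

end Translation

end RangeEq

namespace RangeEq

set_option linter.unusedSectionVars false

open MeasureTheory Topology
open scoped NNReal ENNReal ContDiff

section Banach

variable {X : Type*} [NormedAddCommGroup X] [NormedSpace ℝ X] [CompleteSpace X]

lemma fixed_point (Ψ : X → X) (w0 : X) (δ : ℝ) (hδ : 0 ≤ δ) (Z : Set X) (hZ : IsClosed Z)
    (hw0 : w0 ∈ Z) (hmap : ∀ w ∈ Z, ‖w - w0‖ ≤ δ → w0 + Ψ w ∈ Z)
    (hlip : ∀ w w', ‖w - w0‖ ≤ δ → ‖w' - w0‖ ≤ δ → ‖Ψ w - Ψ w'‖ ≤ 1 / 2 * ‖w - w'‖)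
    (h0 : ‖Ψ w0‖ ≤ δ / 2) : ∃ w ∈ Z, ‖w - w0‖ ≤ δ ∧ w = w0 + Ψ w := by
  set s : Set X := Z ∩ Metric.closedBall w0 δ with hs
  have hmem : ∀ w, w ∈ s ↔ w ∈ Z ∧ ‖w - w0‖ ≤ δ := by
    intro w; rw [hs, Set.mem_inter_iff, mem_closedBall_iff_norm]
  have hsc : IsComplete s := (hZ.inter Metric.isClosed_closedBall).isComplete
  have hself : ‖w0 - w0‖ ≤ δ := by simpa using hδ
  have hms : Set.MapsTo (fun w => w0 + Ψ w) s s := by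
    intro w hw
    rw [hmem] at hw
    rw [hmem]
    refine ⟨hmap w hw.1 hw.2, ?_⟩
    have h1 := hlip w w0 hw.2 hself
    have h2 : ‖Ψ w‖ ≤ ‖Ψ w - Ψ w0‖ + ‖Ψ w0‖ := by
      simpa using norm_add_le (Ψ w - Ψ w0) (Ψ w0)
    have h3 := hw.2
    simp only [add_sub_cancel_left]
    linarith
  have hc : ContractingWith (1 / 2) (hms.restrict (fun w => w0 + Ψ w) s s) := by
    refine ⟨by norm_num [div_lt_one], ?_⟩
    refine LipschitzWith.of_dist_le_mul fun a b => ?_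
    have ha := (hmem _).1 a.2
    have hb := (hmem _).1 b.2
    have := hlip a b ha.2 hb.2
    rw [Subtype.dist_eq, Subtype.dist_eq]
    simp only [Set.MapsTo.val_restrict_apply, dist_eq_norm, add_sub_add_left_eq_sub]
    simpa using this
  obtain ⟨y, hy, hfix, -⟩ := hc.exists_fixedPoint' hsc hms ((hmem w0).2 ⟨hw0, hself⟩)
    (edist_ne_top _ _)
  exact ⟨y, ((hmem y).1 hy).1, ((hmem y).1 hy).2, hfix.eq.symm⟩

lemma curve_analytic {F : Type*} [NormedAddCommGroup F] [NormedSpace ℝ F] (Ψ : X → X) (w : X)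
    (hΨ : AnalyticAt ℝ Ψ w)
    (hlip : ∀ᶠ w' in 𝓝 w, ‖Ψ w' - Ψ w‖ ≤ 1 / 2 * ‖w' - w‖)
    (W Y : F → X) (hW : ContinuousAt W 0) (hW0 : W 0 = w) (hY : AnalyticAt ℝ Y 0)
    (hWY : ∀ ψ, Ψ (W ψ) = W ψ - Y ψ) : AnalyticAt ℝ W 0 := by
  have hd := hΨ.differentiableAt.hasFDerivAt
  have hnorm : ‖fderiv ℝ Ψ w‖ ≤ 1 / 2 := hd.le_of_lip' (by norm_num) hlip
  have hlt : ‖fderiv ℝ Ψ w‖ < 1 := by linarith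
  let e : X ≃L[ℝ] X := ContinuousLinearEquiv.unitsEquiv ℝ X (Units.oneSub _ hlt)
  let Φ : X → X := fun v => v - Ψ v
  have hΦ : AnalyticAt ℝ Φ w := analyticAt_id.sub hΨ
  have hΦc : ContDiffAt ℝ ω Φ w := hΦ.contDiffAt
  have hΦd : HasFDerivAt Φ (e : X →L[ℝ] X) w := (hasFDerivAt_id w).sub hd
  have hne : (ω : WithTop ℕ∞) ≠ 0 := by simp
  have hinv : AnalyticAt ℝ (hΦc.localInverse hΦd hne) (Φ w) :=
    (hΦc.to_localInverse hΦd hne).analyticAt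
  have hΦW : ∀ ψ, Φ (W ψ) = Y ψ := by
    intro ψ; simp only [Φ]; rw [hWY]; abel
  have hY0 : Y 0 = Φ w := by rw [← hΦW, hW0]
  have hcomp : AnalyticAt ℝ (fun ψ => hΦc.localInverse hΦd hne (Y ψ)) 0 := by
    rw [← hY0] at hinv
    exact hinv.comp hY
  refine hcomp.congr ?_
  have hleft := (hΦc.hasStrictFDerivAt' hΦd hne).eventually_left_inverse
  have hW' : Tendsto W (𝓝 0) (𝓝 w) := hW0 ▸ hW
  filter_upwards [hW'.eventually hleft] with ψ hψ
  rw [← hΦW]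
  exact hψ

end Banach

section Main

variable {T : Type*} [TopologicalSpace T] [CompactSpace T] [AddCommGroup T]
  [IsTopologicalAddGroup T]
variable {E : Type*} [NormedAddCommGroup E] [NormedSpace ℝ E] [CompleteSpace E]

lemma HD.add {θ : ℝ →+ T} {F F' G G' : C(T, E)} (h : HD θ F F') (k : HD θ G G') :
    HD θ (F + G) (F' + G') := fun x s => (h x s).add (k x s)

lemma HD.sub {θ : ℝ →+ T} {F F' G G' : C(T, E)} (h : HD θ F F') (k : HD θ G G') :
    HD θ (F - G) (F' - G') := fun x s => (h x s).sub (k x s)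

lemma HD.smul {θ : ℝ →+ T} {F F' : C(T, E)} (a : ℝ) (h : HD θ F F') :
    HD θ (a • F) (a • F') := fun x s => (h x s).const_smul a

lemma HD.pw {G : Type*} [NormedAddCommGroup G] [NormedSpace ℝ G] {θ : ℝ →+ T}
    {F F' : C(T, E)} (L : E →L[ℝ] G) (h : HD θ F F') :
    HD θ (RangeEq.pw L F) (RangeEq.pw L F') := fun x s => L.hasFDerivAt.comp_hasDerivAt s (h x s)

lemma Decay.smul {P : E →L[ℝ] E} {C l a : ℝ} (hP : Decay P C l) (ha : 0 < a) :
    Decay (a • P) C (a * l) := by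
  intro t ht
  rw [Sg_smul]
  refine (hP (a * t) (by positivity)).trans (le_of_eq ?_)
  ring_nf

lemma pw_smul (a : ℝ) (P : E →L[ℝ] E) (F : C(T, E)) : pw (a • P) F = a • pw P F := by
  ext x; simp

lemma exists_K (θ : ℝ →+ T) (hθ : Continuous θ) (P : E →L[ℝ] E) {C l : ℝ} (hP : Decay P C l)
    (hl : 0 < l) (μ : C(T, E) →L[ℝ] E)
    (hμ : ∀ (L : E →L[ℝ] E) a h, μ (pw L (tr a h)) = L (μ h)) (a : ℝ) (ha : 0 < a) :
    ∃ K : C(T, E) →L[ℝ] C(T, E), ‖K‖ ≤ C / l ∧ (∀ b h, tr b (K h) = K (tr b h)) ∧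
      (∀ h, μ h = 0 → μ (K h) = 0) ∧ (∀ h, HD θ (K h) (a • (h - pw P (K h)))) ∧
      (∀ F F', HD θ F F' → HD θ (K F) (K F') ∧ K F' = a • (F - K (pw P F))) := by
  have hM := hP.smul ha
  have hl' : 0 < a * l := by positivity
  refine ⟨a • Rop θ hθ (a • P) hM hl', ?_, ?_, ?_, ?_, ?_⟩
  · rw [norm_smul, Real.norm_of_nonneg ha.le]
    refine (mul_le_mul_of_nonneg_left (Rop_norm θ hθ hM hl') ha.le).trans (le_of_eq ?_)
    field_simp
  · intro b h
    simp [Rop_tr]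
  · intro h h0
    simp [Rop_mean θ hθ hM hl' μ hμ h h0]
  · intro h
    have := (Rop_right θ hθ hM hl' h).smul a
    simpa [pw_smul] using this
  · intro F F' hF
    refine ⟨(Rop_HD θ hθ hM hl' hF).smul a, ?_⟩
    have := Rop_left θ hθ hM hl' hF
    rw [map_add, pw_smul, map_smul] at this
    rw [_root_.smul_apply, _root_.smul_apply]
    congr 1
    exact eq_sub_of_add_eq this

lemma tr_continuous {F : Type*} [TopologicalSpace F] (φ : F → T) (hφ : Continuous φ) (U : C(T, E)) :
    Continuous fun ψ => tr (φ ψ) U :=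
  (ContinuousMap.curry ⟨fun p : F × T => U (p.2 + φ p.1), by fun_prop⟩).continuous

lemma tr_add (a b : T) (U : C(T, E)) : tr (a + b) U = tr a (tr b U) := by
  ext x; simp [add_assoc]

set_option maxHeartbeats 2000000 in
theorem abstract_main {F : Type*} [NormedAddCommGroup F] [NormedSpace ℝ F]
    (φ : F →+ T) (hφ : IsOpenQuotientMap φ)
    (θ : ℝ →+ T) (hθ : Continuous θ) (μ : C(T, E) →L[ℝ] E)
    (hμ : ∀ (L : E →L[ℝ] E) a h, μ (pw L (tr a h)) = L (μ h)) (hμc : ∀ v, μ (cst v) = v)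
    (Γ A B : E →L[ℝ] E) (hΓB : ∀ v, Γ (B v) = A v) {C₁ l₁ C₂ l₂ : ℝ}
    (hΓ : Decay Γ C₁ l₁) (hl₁ : 0 < l₁) (hB : Decay B C₂ l₂) (hl₂ : 0 < l₂)
    (g : E → E) (hg : Continuous g) (c : E) (hga : AnalyticAt ℝ g c) (hA : fderiv ℝ g c = A)
    (f : C(T, E)) (hf : AnalyticOnNhd ℝ (fun y => f (φ y)) Set.univ)
    (hdense : ∀ δ > 0, ∃ G G' : C(T, E), HD θ G G' ∧ ‖f - cst (μ f) - G'‖ ≤ δ) :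
    ∃ εbar > (0 : ℝ), ∃ ζbar > (0 : ℝ), ∀ ε ∈ Set.Ioo (0 : ℝ) εbar, ∀ ζ : E, ‖ζ‖ < ζbar →
      ∃ U U1 U2 : C(T, E), AnalyticOnNhd ℝ (fun y => U (φ y)) Set.univ ∧ μ U = 0 ∧
        HD θ U U1 ∧ HD θ U1 U2 ∧
        ∀ x, ε • U2 x + Γ (U1 x)
          + ε • (g (c + ζ + U x) - μ (post (fun v => g (c + ζ + v)) (by fun_prop) U))
          = ε • (f x - μ f) := by
  set N : C(T, E) → C(T, E) := post (fun v => g (c + v)) (by fun_prop) with hN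
  obtain ⟨p, r, hp, hp1⟩ := post_analytic (T := T) g hg c hga
  set H : C(T, E) → C(T, E) := fun V => N V - pw A V with hH
  have hHan : ∀ V, V ∈ Metric.eball (0 : C(T, E)) r → AnalyticAt ℝ H V := fun V hV =>
    (hp.analyticOnNhd V hV).sub ((pw A).analyticAt V)
  have hHstrict : HasStrictFDerivAt H (0 : C(T, E) →L[ℝ] C(T, E)) 0 := by
    have h1 := hp.hasFPowerSeriesAt.hasStrictFDerivAt.sub (pw A : C(T, E) →L[ℝ] C(T, E)).hasStrictFDerivAt
    refine h1.congr_fderiv ?_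
    ext U x
    have := hp1 U x
    simp only [continuousMultilinearCurryFin1_apply, _root_.sub_apply, ContinuousMap.sub_apply,
      pw_apply, ContinuousMap.zero_apply, _root_.zero_apply]
    rw [← hA, ← this, sub_eq_zero]
    congr 2
  set k₁ := C₁ / l₁ with hk₁
  set k₂ := C₂ / l₂ with hk₂
  have hk₁0 : 0 ≤ k₁ := div_nonneg hΓ.nonneg hl₁.le
  have hk₂0 : 0 ≤ k₂ := div_nonneg hB.nonneg hl₂.le
  set Pr : C(T, E) →L[ℝ] C(T, E) := ContinuousLinearMap.id ℝ _ - cst.comp μ with hPr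
  have hPra : ∀ h, Pr h = h - cst (μ h) := fun h => rfl
  have hμPr : ∀ h, μ (Pr h) = 0 := by intro h; rw [hPra, map_sub, hμc, sub_self]
  have hPrc : ∀ v, Pr (cst v) = 0 := by intro v; rw [hPra, hμc, sub_self]
  have hμtr : ∀ a h, μ (tr a h) = μ h := by
    intro a h
    exact hμ (ContinuousLinearMap.id ℝ E) a h
  have hμpw : ∀ L h, μ (pw L h) = L (μ h) := by
    intro L h
    have := hμ L 0 h
    rwa [show tr 0 h = h by ext x; simp] at this
  have hPrtr : ∀ a h, Pr (tr a h) = tr a (Pr h) := by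
    intro a h; ext x; simp [hPra, hμtr]
  set b := ‖B‖
  -- constants
  set η : ℝ := 1 / (4 * ((k₁ + 1) * (‖Pr‖ + 1) * (k₂ + 1))) with hη
  have hη0 : 0 < η := by positivity
  have hkη : k₁ * (‖Pr‖ * η) * (k₂ + 1) ≤ 1 / 4 := by
    have : (k₁ + 1) * ((‖Pr‖ + 1) * η) * (k₂ + 1) = 1 / 4 := by
      rw [hη]; field_simp
    rw [← this]
    gcongr <;> linarith
  have hkη1 : k₁ * (‖Pr‖ * η) ≤ 1 / 4 := by
    refine le_trans ?_ hkη
    exact le_mul_of_one_le_right (by positivity) (by linarith)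
  have hkη2 : k₁ * (‖Pr‖ * (η * k₂)) ≤ 1 / 4 := by
    have e : k₁ * (‖Pr‖ * (η * k₂)) = k₁ * (‖Pr‖ * η) * k₂ := by ring
    rw [e]
    refine le_trans ?_ hkη
    exact mul_le_mul_of_nonneg_left (by linarith : k₂ ≤ k₂ + 1) (by positivity)
  obtain ⟨ρ, hρ0, hρan, hρlip⟩ : ∃ ρ > 0, (∀ V : C(T, E), ‖V‖ < ρ → AnalyticAt ℝ H V) ∧
      ∀ V V' : C(T, E), ‖V‖ < ρ → ‖V'‖ < ρ → ‖H V - H V'‖ ≤ η * ‖V - V'‖ := by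
    have h1 := hHstrict.isLittleO.def hη0
    rw [Metric.eventually_nhds_iff] at h1
    obtain ⟨ρ₁, hρ₁, h1⟩ := h1
    obtain ⟨ρ₂, hρ₂, h2⟩ := Metric.mem_nhds_iff.1 (Metric.eball_mem_nhds (0 : C(T, E)) hp.r_pos)
    refine ⟨min ρ₁ ρ₂, lt_min hρ₁ hρ₂, fun V hV => hHan V (h2 ?_), fun V V' hV hV' => ?_⟩
    · rw [mem_ball_zero_iff]; exact hV.trans_le (min_le_right _ _)
    · have := h1 (y := (V, V')) (by
        rw [dist_eq_norm]
        simp only [Prod.norm_def]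
        simpa using ⟨(lt_min_iff.1 hV).1, (lt_min_iff.1 hV').1⟩)
      simpa using this
  set δ := ρ / (4 * (k₂ + 1)) with hδ
  have hδ0 : 0 < δ := by positivity
  have hk₂δ : k₂ * δ ≤ ρ / 4 := by
    have : (k₂ + 1) * δ = ρ / 4 := by rw [hδ]; field_simp
    nlinarith
  have hδρ : δ ≤ ρ / 4 := by
    have : (k₂ + 1) * δ = ρ / 4 := by rw [hδ]; field_simp
    nlinarith
  set D := k₁ * (b * (1 + b * k₂)) with hD
  have hD0 : 0 ≤ D := by positivity
  obtain ⟨G, G', hGG, hG⟩ := hdense (δ / 2 / (k₂ * k₁ + 1)) (by positivity)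
  obtain ⟨εbar, hεbar, hsmall⟩ : ∃ εbar > (0 : ℝ), ∀ ε ∈ Set.Ioo (0 : ℝ) εbar,
      ε ^ 2 * D < 1 / 4 ∧ ε ^ 2 * D * (k₁ * ‖Pr f‖) < δ / 4 ∧
        ε * ((1 + k₂ * b) * (k₁ * ‖G‖)) < δ / 2 := by
    have h1 : ∀ᶠ ε in 𝓝 (0 : ℝ), ε ^ 2 * D < 1 / 4 :=
      ContinuousAt.eventually_lt (by fun_prop) (by fun_prop) (by norm_num)
    have h2 : ∀ᶠ ε in 𝓝 (0 : ℝ), ε ^ 2 * D * (k₁ * ‖Pr f‖) < δ / 4 :=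
      ContinuousAt.eventually_lt (by fun_prop) (by fun_prop) (by simp; positivity)
    have h3 : ∀ᶠ ε in 𝓝 (0 : ℝ), ε * ((1 + k₂ * b) * (k₁ * ‖G‖)) < δ / 2 :=
      ContinuousAt.eventually_lt (by fun_prop) (by fun_prop) (by simp; positivity)
    obtain ⟨e, he, h⟩ := Metric.eventually_nhds_iff.1 (h1.and (h2.and h3))
    refine ⟨e, he, fun ε hε => h ?_⟩
    rw [dist_zero_right, Real.norm_of_nonneg hε.1.le]
    exact hε.2
  refine ⟨εbar, hεbar, ρ / 4, by positivity, fun ε hε ζ hζ => ?_⟩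
  obtain ⟨hs1, hs2, hs3⟩ := hsmall ε hε
  have hε0 : 0 < ε := hε.1
  obtain ⟨K₁, hK₁n, hK₁tr, hK₁μ, hK₁r, hK₁l⟩ := exists_K θ hθ Γ hΓ hl₁ μ hμ ε⁻¹ (by positivity)
  obtain ⟨K₂, hK₂n, hK₂tr, hK₂μ, hK₂r, hK₂l⟩ := exists_K θ hθ B hB hl₂ μ hμ ε hε0
  have hK₁b : ∀ h, ‖K₁ h‖ ≤ k₁ * ‖h‖ := fun h => K₁.le_of_opNorm_le hK₁n h
  have hK₂b : ∀ h, ‖K₂ h‖ ≤ k₂ * ‖h‖ := fun h => K₂.le_of_opNorm_le hK₂n h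
  set w0 := K₁ (Pr f) with hw0
  have hw0μ : μ w0 = 0 := hK₁μ _ (hμPr f)
  have hK₂w0 : ‖K₂ w0‖ ≤ δ := by
    have e1 : K₂ w0 = K₂ (K₁ G') + K₂ (K₁ (f - cst (μ f) - G')) := by
      rw [hw0, hPra, ← map_add, ← map_add]; congr 2; abel
    have e2 : K₂ (K₁ G') = ε • (K₁ G - K₂ (pw B (K₁ G))) := (hK₂l _ _ (hK₁l _ _ hGG).1).2
    have e3 : ‖K₂ (K₁ G')‖ ≤ ε * ((1 + k₂ * b) * (k₁ * ‖G‖)) := by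
      rw [e2, norm_smul, Real.norm_of_nonneg hε0.le]
      gcongr
      refine (norm_sub_le _ _).trans ?_
      have i1 := hK₁b G
      have i2 : ‖K₂ (pw B (K₁ G))‖ ≤ k₂ * (b * (k₁ * ‖G‖)) := by
        refine (hK₂b _).trans ?_
        gcongr
        refine (pw_norm_le _ _).trans ?_
        gcongr
      linarith
    have e4 : ‖K₂ (K₁ (f - cst (μ f) - G'))‖ ≤ δ / 2 := by
      refine (hK₂b _).trans ?_
      have i1 : k₂ * ‖K₁ (f - cst (μ f) - G')‖ ≤ k₂ * (k₁ * (δ / 2 / (k₂ * k₁ + 1))) := by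
        gcongr
        refine (hK₁b _).trans ?_
        gcongr
      refine i1.trans ?_
      rw [← mul_assoc, mul_div_assoc', div_le_iff₀ (by positivity)]
      nlinarith
    rw [e1]
    refine (norm_add_le _ _).trans ?_
    linarith
  set Q : C(T, E) → C(T, E) := fun w => pw B (w - pw B (K₂ w)) with hQ
  set Ψ : C(T, E) → C(T, E) := fun w => K₁ (ε ^ 2 • Q w - Pr (H (cst ζ + K₂ w))) with hΨ
  have hQlip : ∀ w w', ‖Q w - Q w'‖ ≤ b * (1 + b * k₂) * ‖w - w'‖ := by
    intro w w'
    have : Q w - Q w' = pw B ((w - w') - pw B (K₂ (w - w'))) := by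
      simp only [hQ, map_sub]; abel
    rw [this]
    refine (pw_norm_le _ _).trans ?_
    rw [mul_assoc]
    gcongr
    refine (norm_sub_le _ _).trans ?_
    have i2 : ‖pw B (K₂ (w - w'))‖ ≤ b * (k₂ * ‖w - w'‖) := by
      refine (pw_norm_le _ _).trans ?_
      gcongr
      exact hK₂b _
    linarith
  have hΨd : ∀ w w', ‖cst ζ + K₂ w‖ < ρ → ‖cst ζ + K₂ w'‖ < ρ →
      ‖Ψ w - Ψ w'‖ ≤ ε ^ 2 * D * ‖w - w'‖ + k₁ * (‖Pr‖ * η) * ‖K₂ (w - w')‖ := by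
    intro w w' hw hw'
    have : Ψ w - Ψ w' = K₁ (ε ^ 2 • (Q w - Q w')
        - Pr (H (cst ζ + K₂ w) - H (cst ζ + K₂ w'))) := by
      simp only [hΨ, map_sub, smul_sub]; abel
    rw [this]
    refine (hK₁b _).trans ?_
    have i1 : ‖ε ^ 2 • (Q w - Q w')‖ ≤ ε ^ 2 * (b * (1 + b * k₂) * ‖w - w'‖) := by
      rw [norm_smul, Real.norm_of_nonneg (by positivity)]
      gcongr
      exact hQlip w w'
    have i2 : ‖Pr (H (cst ζ + K₂ w) - H (cst ζ + K₂ w'))‖ ≤ ‖Pr‖ * (η * ‖K₂ (w - w')‖) := by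
      refine (Pr.le_opNorm _).trans ?_
      gcongr
      refine (hρlip _ _ hw hw').trans (le_of_eq ?_)
      rw [add_sub_add_left_eq_sub, map_sub]
    have i3 := norm_sub_le (ε ^ 2 • (Q w - Q w')) (Pr (H (cst ζ + K₂ w) - H (cst ζ + K₂ w')))
    calc _ ≤ k₁ * (ε ^ 2 * (b * (1 + b * k₂) * ‖w - w'‖) + ‖Pr‖ * (η * ‖K₂ (w - w')‖)) := by
          gcongr; linarith
      _ = _ := by rw [hD]; ring
  have hΨlip : ∀ w w', ‖cst ζ + K₂ w‖ < ρ → ‖cst ζ + K₂ w'‖ < ρ →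
      ‖Ψ w - Ψ w'‖ ≤ 1 / 2 * ‖w - w'‖ := by
    intro w w' hw hw'
    refine (hΨd w w' hw hw').trans ?_
    have i1 : k₁ * (‖Pr‖ * η) * ‖K₂ (w - w')‖ ≤ k₁ * (‖Pr‖ * η) * (k₂ * ‖w - w'‖) := by
      gcongr; exact hK₂b _
    have i2 : k₁ * (‖Pr‖ * (η * k₂)) * ‖w - w'‖ ≤ 1 / 4 * ‖w - w'‖ := by gcongr
    have i3 : ε ^ 2 * D * ‖w - w'‖ ≤ 1 / 4 * ‖w - w'‖ := by gcongr
    linarith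
  have hball : ∀ w, ‖w - w0‖ ≤ δ → ‖cst ζ + K₂ w‖ < ρ := by
    intro w hw
    have e : cst ζ + K₂ w = cst ζ + (K₂ w0 + K₂ (w - w0)) := by rw [← map_add]; congr 2; abel
    rw [e]
    have i1 := norm_add_le (cst ζ) (K₂ w0 + K₂ (w - w0))
    have i2 := norm_add_le (K₂ w0) (K₂ (w - w0))
    have i3 := hK₂b (w - w0)
    have i4 : k₂ * ‖w - w0‖ ≤ k₂ * δ := by gcongr
    have i5 : ‖(cst ζ : C(T, E))‖ ≤ ‖ζ‖ := cst_norm_le ζ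
    linarith
  have hΨ0 : ‖Ψ w0‖ ≤ δ / 2 := by
    have hz : ‖cst ζ + K₂ (0 : C(T, E))‖ < ρ := by
      rw [map_zero, add_zero]
      have i5 : ‖(cst ζ : C(T, E))‖ ≤ ‖ζ‖ := cst_norm_le ζ
      linarith
    have hΨz : Ψ 0 = 0 := by
      have : H (cst ζ + K₂ 0) = cst (g (c + ζ) - A ζ) := by
        ext x; simp [hH, hN, post]
      simp only [hΨ]
      rw [this, hPrc]
      simp [hQ]
    have h1 := hΨd w0 0 (hball w0 (by simpa using hδ0.le)) hz
    rw [hΨz, sub_zero, sub_zero] at h1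
    have i1 : ε ^ 2 * D * ‖w0‖ ≤ ε ^ 2 * D * (k₁ * ‖Pr f‖) := by gcongr; exact hK₁b _
    have i2 : k₁ * (‖Pr‖ * η) * ‖K₂ w0‖ ≤ 1 / 4 * δ := by gcongr
    linarith
  obtain ⟨w, hwμ, hwδ, hweq⟩ := fixed_point Ψ w0 δ hδ0.le {w | μ w = 0}
    (isClosed_eq μ.continuous continuous_const) hw0μ (by
      intro w hw _
      simp only [Set.mem_ofPred_eq] at hw ⊢
      rw [map_add, hw0μ, zero_add]
      refine hK₁μ _ ?_
      rw [map_sub, hμPr, sub_zero, map_smul, hQ]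
      simp only
      rw [hμpw, map_sub, hw, hμpw, hK₂μ _ hw]
      simp) (fun w w' hw hw' => hΨlip w w' (hball w hw) (hball w' hw')) hΨ0
  simp only [Set.mem_ofPred_eq] at hwμ
  have hwρ := hball w hwδ
  set U := K₂ w with hU
  -- analyticity
  have hΨan : AnalyticAt ℝ Ψ w := by
    have a1 : AnalyticAt ℝ (fun w => H (cst ζ + K₂ w)) w :=
      AnalyticAt.comp (g := H) (f := fun w => cst ζ + K₂ w) (hρan _ hwρ)
        (analyticAt_const.add (K₂.analyticAt w))
    have a2 : AnalyticAt ℝ (fun w => Pr (H (cst ζ + K₂ w))) w := (Pr.analyticAt _).comp a1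
    have a3 : AnalyticAt ℝ Q w :=
      ((pw B).comp (ContinuousLinearMap.id ℝ _ - (pw B).comp K₂)).analyticAt w
    have a4 : AnalyticAt ℝ (fun w => ε ^ 2 • Q w - Pr (H (cst ζ + K₂ w))) w :=
      (AnalyticAt.fun_smul (analyticAt_const (v := ε ^ 2)) a3).sub a2
    exact (K₁.analyticAt _).comp a4
  have hΨev : ∀ᶠ w' in 𝓝 w, ‖Ψ w' - Ψ w‖ ≤ 1 / 2 * ‖w' - w‖ := by
    have : ∀ᶠ w' in 𝓝 w, ‖cst ζ + K₂ w'‖ < ρ :=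
      ContinuousAt.eventually_lt (by fun_prop) (by fun_prop) hwρ
    filter_upwards [this] with w' hw'
    exact hΨlip _ _ hw' hwρ
  have hHtr : ∀ a V, H (tr a V) = tr a (H V) := by
    intro a V; ext x; simp [hH, hN, post]
  have hΨtr : ∀ a v, Ψ (tr a v) = tr a (Ψ v) := by
    intro a v
    have e1 : cst ζ + K₂ (tr a v) = tr a (cst ζ + K₂ v) := by
      rw [← hK₂tr, map_add]; rfl
    have e2 : Q (tr a v) = tr a (Q v) := by
      simp only [hQ]; rw [← hK₂tr]; ext x; simp
    simp only [hΨ]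
    rw [e1, e2, hHtr, hPrtr, hK₁tr, map_sub (tr a), map_smul (tr a)]
  have hWan : AnalyticAt ℝ (fun ψ => tr (φ ψ) w) 0 := by
    refine curve_analytic Ψ w hΨan hΨev (fun ψ => tr (φ ψ) w) (fun ψ => tr (φ ψ) w0)
      (tr_continuous φ hφ.continuous w).continuousAt ?_ ?_ ?_
    · ext x; simp
    · have a1 := tr_analytic φ hφ f hf
      have : (fun ψ => tr (φ ψ) w0) = fun ψ => (K₁.comp Pr) (tr (φ ψ) f) := by
        ext1 ψ
        rw [hw0, hK₁tr, ← hPrtr]; rfl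
      rw [this]
      exact ((K₁.comp Pr).analyticAt _).comp a1
    · intro ψ
      rw [hΨtr, ← map_sub]
      congr 1
      rw [eq_sub_iff_add_eq, add_comm]; exact hweq.symm
  have hUan : AnalyticOnNhd ℝ (fun y => U (φ y)) Set.univ := by
    intro y _
    have e : (fun z => U (φ z)) = fun z => (ev (φ y)) (K₂ (tr (φ (z - y)) w)) := by
      ext z
      rw [← hK₂tr]
      change U (φ z) = U (φ y + φ (z - y))
      rw [← map_add]; congr 2; abel
    rw [e]
    have a1 : AnalyticAt ℝ (fun z => tr (φ (z - y)) w) y := by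
      refine AnalyticAt.comp_of_eq (g := fun ψ => tr (φ ψ) w) (f := fun z => z - y) hWan
        (analyticAt_id.sub analyticAt_const) (sub_self y)
    exact (((ev (φ y)).comp K₂).analyticAt _).comp a1
  -- the equation
  set Fr : C(T, E) := Pr f + (ε ^ 2 • Q w - Pr (H (cst ζ + U))) with hFr
  have hwF : w = K₁ Fr := by
    rw [hFr, map_add]; exact hweq
  have hμU : μ U = 0 := hK₂μ w hwμ
  have hU1 := hK₂r w
  rw [← hU] at hU1
  have hw1 := hK₁r Fr
  rw [← hwF] at hw1
  have hU2 := (hw1.sub (hU1.pw B)).smul ε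
  refine ⟨U, _, _, hUan, hμU, hU1, hU2, fun x => ?_⟩
  have hNμ : μ (post (fun v => g (c + ζ + v)) (by fun_prop) U)
      = μ (H (cst ζ + U)) + A ζ := by
    have : post (fun v => g (c + ζ + v)) (by fun_prop) U
        = H (cst ζ + U) + pw A (cst ζ + U) := by
      ext x; simp [hH, hN, post, add_assoc]
    rw [this, map_add, hμpw, map_add, hμU, hμc, add_zero]
  rw [hNμ]
  have hHx : H (cst ζ + U) x = g (c + (ζ + U x)) - A (ζ + U x) := rfl
  simp only [hFr, hPra, hQ, ← hU, ContinuousMap.add_apply, ContinuousMap.sub_apply,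
    ContinuousMap.smul_apply, pw_apply, cst_apply, hHx, map_sub, map_smul, map_add, hΓB, add_assoc]
  have hεε : ε * ε⁻¹ = 1 := mul_inv_cancel₀ hε0.ne'
  simp only [smul_sub, smul_add, smul_smul, hεε, one_smul, pow_two]
  have hεε3 : ε * (ε * (ε⁻¹ * (ε * ε))) = ε * (ε * ε) := by field_simp
  rw [hεε3]
  module

end Main

end RangeEq

namespace RangeEq

set_option linter.unusedSectionVars false

open MeasureTheory Topology

section Density

variable {d : ℕ}

lemma HD_fourier (ω : Fin d → ℝ) (θ : ℝ →+ UnitAddTorus (Fin d))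
    (hθ : ∀ s j, θ s j = ((s * ω j / (2 * π) : ℝ) : UnitAddCircle)) (n : Fin d → ℤ) (z : ℂ) :
    HD θ (z • UnitAddTorus.mFourier n)
      ((z * (Complex.I * ((∑ j, ω j * n j : ℝ) : ℂ))) • UnitAddTorus.mFourier n) := by
  have key : ∀ (x : UnitAddTorus (Fin d)) (s : ℝ), UnitAddTorus.mFourier n (x + θ s)
      = UnitAddTorus.mFourier n x * Complex.exp (s * (Complex.I * ((∑ j, ω j * n j : ℝ) : ℂ))) := by
    intro x s
    have h1 : UnitAddTorus.mFourier n (x + θ s)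
        = UnitAddTorus.mFourier n x * UnitAddTorus.mFourier n (θ s) := by
      simp only [UnitAddTorus.mFourier, ContinuousMap.coe_mk, ← Finset.prod_mul_distrib]
      refine Finset.prod_congr rfl fun j _ => ?_
      simp only [fourier_apply, Pi.add_apply, smul_add, AddCircle.toCircle_add, Circle.coe_mul]
    rw [h1]
    congr 1
    simp only [UnitAddTorus.mFourier, ContinuousMap.coe_mk, hθ, fourier_coe_apply]
    rw [← Complex.exp_sum]
    congr 1
    push_cast
    rw [Finset.mul_sum, Finset.mul_sum]
    refine Finset.sum_congr rfl fun j _ => ?_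
    have : (π : ℂ) ≠ 0 := by exact_mod_cast Real.pi_ne_zero
    field_simp
  intro x s
  set a : ℂ := Complex.I * ((∑ j, ω j * n j : ℝ) : ℂ) with ha
  have hd : HasDerivAt (fun s : ℝ => Complex.exp (s * a)) (Complex.exp (s * a) * (1 * a)) s := by
    have h0 : HasDerivAt (fun s : ℝ => (s : ℂ) * a) (1 * a) s :=
      (Complex.ofRealCLM.hasDerivAt (x := s)).mul_const a
    exact h0.cexp
  have hd2 := (hd.const_mul (UnitAddTorus.mFourier n x)).const_mul z
  simp only [ContinuousMap.smul_apply, smul_eq_mul, key]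
  refine hd2.congr_deriv ?_
  ring

lemma dense_complex (ω : Fin d → ℝ) (hω : ∀ ν : Fin d → ℤ, ν ≠ 0 → (∑ j, ω j * ν j) ≠ 0)
    (θ : ℝ →+ UnitAddTorus (Fin d))
    (hθ : ∀ s j, θ s j = ((s * ω j / (2 * π) : ℝ) : UnitAddCircle))
    (h : C(UnitAddTorus (Fin d), ℂ)) (δ : ℝ) (hδ : 0 < δ) :
    ∃ (z : ℂ) (F F' : C(UnitAddTorus (Fin d), ℂ)), HD θ F F' ∧ ‖h - cst z - F'‖ ≤ δ := by
  have hspan : ∀ k ∈ Submodule.span ℂ (Set.range (UnitAddTorus.mFourier (d := Fin d))),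
      ∃ (z : ℂ) (F F' : C(UnitAddTorus (Fin d), ℂ)), HD θ F F' ∧ k = cst z + F' := by
    intro k hk
    induction hk using Submodule.span_induction with
    | mem k hk =>
      obtain ⟨n, rfl⟩ := hk
      by_cases hn : n = 0
      · refine ⟨1, 0, 0, fun x s => hasDerivAt_const _ _, ?_⟩
        rw [hn, UnitAddTorus.mFourier_zero]
        ext x; simp
      · refine ⟨0, _, _, HD_fourier ω θ hθ n
          (Complex.I * ((∑ j, ω j * n j : ℝ) : ℂ))⁻¹, ?_⟩
        have : (Complex.I * ((∑ j, ω j * n j : ℝ) : ℂ)) ≠ 0 :=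
          mul_ne_zero Complex.I_ne_zero (by exact_mod_cast hω n hn)
        rw [inv_mul_cancel₀ this]
        simp
    | zero => exact ⟨0, 0, 0, fun x s => hasDerivAt_const _ _, by simp⟩
    | add k l _ _ hk hl =>
      obtain ⟨z, F, F', hF, rfl⟩ := hk
      obtain ⟨y, G, G', hG, rfl⟩ := hl
      exact ⟨z + y, F + G, F' + G', hF.add hG, by rw [map_add]; abel⟩
    | smul a k _ hk =>
      obtain ⟨z, F, F', hF, rfl⟩ := hk
      refine ⟨a * z, a • F, a • F', fun x s => (hF x s).const_mul a, ?_⟩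
      ext x; simp [mul_add]
  have hmem : h ∈ closure (Submodule.span ℂ
      (Set.range (UnitAddTorus.mFourier (d := Fin d))) : Set C(UnitAddTorus (Fin d), ℂ)) := by
    have := UnitAddTorus.span_mFourier_closure_eq_top (d := Fin d)
    have h2 : h ∈ (Submodule.span ℂ
      (Set.range (UnitAddTorus.mFourier (d := Fin d)))).topologicalClosure := by
      rw [this]; trivial
    exact h2
  obtain ⟨k, hk, hkd⟩ := Metric.mem_closure_iff.1 hmem δ hδ
  obtain ⟨z, F, F', hF, rfl⟩ := hspan k hk
  refine ⟨z, F, F', hF, ?_⟩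
  rw [dist_eq_norm] at hkd
  rw [sub_sub]
  exact hkd.le

lemma mean_HD {T : Type*} [TopologicalSpace T] [CompactSpace T] [AddCommGroup T]
    [IsTopologicalAddGroup T] {E : Type*} [NormedAddCommGroup E] [NormedSpace ℝ E]
    [CompleteSpace E] (θ : ℝ →+ T) (hθ : Continuous θ) (μ : C(T, E) →L[ℝ] E)
    (hμ : ∀ a h, μ (tr a h) = μ h) (F F' : C(T, E)) (hF : HD θ F F') : μ F' = 0 := by
  have hc : Continuous fun s => tr (θ s) F' := tr_continuous θ hθ F'
  have h1 : ∫ s in (0 : ℝ)..1, tr (θ s) F' = tr (θ 1) F - F := by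
    ext x
    have e1 := (ev x : C(T, E) →L[ℝ] E).intervalIntegral_comp_comm (hc.intervalIntegrable (μ := volume) 0 1)
    have e2 := intervalIntegral.integral_eq_sub_of_hasDerivAt (a := 0) (b := 1)
      (f := fun s => F (x + θ s)) (f' := fun s => F' (x + θ s)) (fun s _ => hF x s)
      (Continuous.intervalIntegrable (by fun_prop) 0 1)
    have e3 : (ev x : C(T, E) →L[ℝ] E) (∫ s in (0 : ℝ)..1, tr (θ s) F')
      = (∫ s in (0 : ℝ)..1, tr (θ s) F') x := rfl
    rw [← e3, ← e1]
    refine Eq.trans ?_ (e2.trans ?_)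
    · rfl
    · simp
  have h2 := μ.intervalIntegral_comp_comm (hc.intervalIntegrable (μ := volume) 0 1)
  rw [h1, map_sub, hμ, sub_self] at h2
  simpa [hμ] using h2

lemma dense_main {m : ℕ} (ω : Fin d → ℝ)
    (hω : ∀ ν : Fin d → ℤ, ν ≠ 0 → (∑ j, ω j * ν j) ≠ 0)
    (θ : ℝ →+ UnitAddTorus (Fin d)) (hθc : Continuous θ)
    (hθ : ∀ s j, θ s j = ((s * ω j / (2 * π) : ℝ) : UnitAddCircle))
    (μ : C(UnitAddTorus (Fin d), Fin m → ℝ) →L[ℝ] (Fin m → ℝ))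
    (hμ : ∀ a h, μ (tr a h) = μ h) (hμc : ∀ v, μ (cst v) = v)
    (f : C(UnitAddTorus (Fin d), Fin m → ℝ)) (δ : ℝ) (hδ : 0 < δ) :
    ∃ G G' : C(UnitAddTorus (Fin d), Fin m → ℝ), HD θ G G' ∧ ‖f - cst (μ f) - G'‖ ≤ δ := by
  set δ' := δ / (1 + ‖μ‖) with hδ'
  have hδ'0 : 0 < δ' := by positivity
  have hcomp := fun i : Fin m => dense_complex ω hω θ hθ
    (pw (Complex.ofRealCLM.comp (ContinuousLinearMap.proj (R := ℝ) (φ := fun _ : Fin m => ℝ) i)) f)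
    δ' hδ'0
  choose z F F' hF hn using hcomp
  let v : Fin m → ℝ := fun i => (z i).re
  let G : C(UnitAddTorus (Fin d), Fin m → ℝ) := ⟨fun x i => (F i x).re, by fun_prop⟩
  let G' : C(UnitAddTorus (Fin d), Fin m → ℝ) := ⟨fun x i => (F' i x).re, by fun_prop⟩
  have hG : HD θ G G' := by
    intro x s
    rw [hasDerivAt_pi]
    intro i
    exact Complex.reCLM.hasFDerivAt.comp_hasDerivAt s (hF i x s)
  have hb : ‖f - cst v - G'‖ ≤ δ' := by
    refine (ContinuousMap.norm_le _ hδ'0.le).2 fun x => ?_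
    refine (pi_norm_le_iff_of_nonneg hδ'0.le).2 fun i => ?_
    have h1 := (ContinuousMap.norm_coe_le_norm _ x).trans (hn i)
    refine le_trans ?_ h1
    have h2 := Complex.abs_re_le_norm (f x i - z i - F' i x)
    simpa [G', v] using h2
  refine ⟨G, G', hG, ?_⟩
  have e1 : μ (f - cst v - G') = μ f - v := by
    rw [map_sub, map_sub, hμc, mean_HD θ hθc μ hμ G G' hG, sub_zero]
  have e2 : ‖μ f - v‖ ≤ ‖μ‖ * δ' := by
    rw [← e1]; exact (μ.le_opNorm _).trans (by gcongr)
  have e3 : f - cst (μ f) - G' = (f - cst v - G') - cst (μ f - v) := by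
    rw [map_sub]; abel
  rw [e3]
  refine (norm_sub_le _ _).trans ?_
  have e4 := cst_norm_le (T := UnitAddTorus (Fin d)) (μ f - v)
  have e5 : (1 + ‖μ‖) * δ' = δ := by rw [hδ']; field_simp
  linarith

end Density

end RangeEq

namespace RangeEq

set_option linter.unusedSectionVars false

open MeasureTheory Topology Matrix

section Energy

variable {m : ℕ}

lemma posDef_lower (P : Matrix (Fin m) (Fin m) ℝ) (hP : P.PosDef) :
    ∃ a > 0, ∀ x : Fin m → ℝ, a * ‖x‖ ^ 2 ≤ x ⬝ᵥ (P *ᵥ x) := by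
  have hcont : Continuous fun x : Fin m → ℝ => x ⬝ᵥ (P *ᵥ x) := by
    unfold dotProduct mulVec dotProduct; fun_prop
  rcases (Metric.sphere (0 : Fin m → ℝ) 1).eq_empty_or_nonempty with he | hne
  · refine ⟨1, one_pos, fun x => ?_⟩
    have hx : x = 0 := by
      by_contra hx
      have : (‖x‖⁻¹ • x) ∈ Metric.sphere (0 : Fin m → ℝ) 1 := by
        rw [mem_sphere_zero_iff_norm, norm_smul, norm_inv, norm_norm,
          inv_mul_cancel₀ (norm_ne_zero_iff.2 hx)]
      rw [he] at this
      exact this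
    simp [hx]
  · obtain ⟨y, hy, hmin⟩ := (isCompact_sphere (0 : Fin m → ℝ) 1).exists_isMinOn hne
      hcont.continuousOn
    have hy0 : y ≠ 0 := by
      rintro rfl; simp at hy
    refine ⟨y ⬝ᵥ (P *ᵥ y), by simpa using hP.dotProduct_mulVec_pos hy0, fun x => ?_⟩
    by_cases hx : x = 0
    · simp [hx]
    have hxn : ‖x‖ ≠ 0 := norm_ne_zero_iff.2 hx
    have hmem : (‖x‖⁻¹ • x) ∈ Metric.sphere (0 : Fin m → ℝ) 1 := by
      rw [mem_sphere_zero_iff_norm, norm_smul, norm_inv, norm_norm, inv_mul_cancel₀ hxn]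
    have h1 : y ⬝ᵥ (P *ᵥ y) ≤ (‖x‖⁻¹ • x) ⬝ᵥ (P *ᵥ (‖x‖⁻¹ • x)) := hmin hmem
    rw [mulVec_smul, smul_dotProduct, dotProduct_smul, smul_eq_mul, smul_eq_mul] at h1
    calc _ ≤ (‖x‖⁻¹ * (‖x‖⁻¹ * x ⬝ᵥ (P *ᵥ x))) * ‖x‖ ^ 2 := by gcongr
      _ = _ := by field_simp

lemma quad_upper (P : Matrix (Fin m) (Fin m) ℝ) :
    ∃ b > 0, ∀ x : Fin m → ℝ, x ⬝ᵥ (P *ᵥ x) ≤ b * ‖x‖ ^ 2 := by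
  refine ⟨(∑ i, ∑ j, |P i j|) + 1, by positivity, fun x => ?_⟩
  have h : x ⬝ᵥ (P *ᵥ x) ≤ (∑ i, ∑ j, |P i j|) * ‖x‖ ^ 2 := by
    simp only [dotProduct, mulVec, Finset.mul_sum, Finset.sum_mul]
    refine Finset.sum_le_sum fun i _ => Finset.sum_le_sum fun j _ => ?_
    refine (le_abs_self _).trans ?_
    rw [abs_mul, abs_mul]
    have h1 : |x i| ≤ ‖x‖ := norm_le_pi_norm x i
    have h2 : |x j| ≤ ‖x‖ := norm_le_pi_norm x j
    calc |x i| * (|P i j| * |x j|) ≤ ‖x‖ * (|P i j| * ‖x‖) := by gcongr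
      _ = _ := by ring
  nlinarith [sq_nonneg ‖x‖]

lemma energy_decay (P : Matrix (Fin m) (Fin m) ℝ) (hP : P.PosDef)
    (M : (Fin m → ℝ) →L[ℝ] (Fin m → ℝ)) (a : ℝ) (ha : 0 < a)
    (hM : ∀ x, a * ‖x‖ ^ 2 ≤ x ⬝ᵥ (P *ᵥ (M x))) :
    ∃ C l : ℝ, 0 < l ∧ Decay M C l := by
  obtain ⟨p, hp0, hp⟩ := posDef_lower P hP
  obtain ⟨b, hb0, hb⟩ := quad_upper P
  have hsymm : ∀ x y : Fin m → ℝ, x ⬝ᵥ (P *ᵥ y) = y ⬝ᵥ (P *ᵥ x) := by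
    intro x y
    have hPt : Pᵀ = P := by
      have := hP.isHermitian
      rwa [IsHermitian, conjTranspose_eq_transpose_of_trivial] at this
    rw [dotProduct_mulVec, ← mulVec_transpose, hPt, dotProduct_comm]
  set l := a / b with hl
  have hl0 : 0 < l := by positivity
  refine ⟨Real.sqrt (b / p), l, hl0, fun t ht => ?_⟩
  refine ContinuousLinearMap.opNorm_le_bound _ (by positivity) fun x => ?_
  set S : ℝ → Fin m → ℝ := fun t => Sg M t x with hS
  have hSd : ∀ t, HasDerivAt S (-(M (S t))) t := by
    intro t
    have := (Sg_hasDerivAt M t).clm_apply (hasDerivAt_const t x)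
    simpa [hS] using this
  set q : ℝ → ℝ := fun t => Real.exp (2 * l * t) * (S t ⬝ᵥ (P *ᵥ S t)) with hq
  have hquad : ∀ t, HasDerivAt (fun t => S t ⬝ᵥ (P *ᵥ S t)) (-2 * (S t ⬝ᵥ (P *ᵥ (M (S t))))) t := by
    intro t
    have hPS : HasDerivAt (fun t => P *ᵥ S t) (P *ᵥ (-(M (S t)))) t :=
      (LinearMap.toContinuousLinearMap (Matrix.mulVecLin P)).hasFDerivAt.comp_hasDerivAt t (hSd t)
    have h1 : HasDerivAt (fun t => ∑ i, S t i * (P *ᵥ S t) i)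
        (∑ i, ((-(M (S t))) i * (P *ᵥ S t) i + S t i * (P *ᵥ (-(M (S t)))) i)) t :=
      HasDerivAt.fun_sum fun i _ => (hasDerivAt_pi.1 (hSd t) i).mul (hasDerivAt_pi.1 hPS i)
    refine h1.congr_deriv ?_
    rw [Finset.sum_add_distrib]
    change (-(M (S t))) ⬝ᵥ (P *ᵥ S t) + S t ⬝ᵥ (P *ᵥ (-(M (S t)))) = _
    rw [hsymm (-(M (S t))), mulVec_neg, dotProduct_neg]
    ring
  have hqd : ∀ t, HasDerivAt q (Real.exp (2 * l * t) * (2 * l * (S t ⬝ᵥ (P *ᵥ S t))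
      - 2 * (S t ⬝ᵥ (P *ᵥ (M (S t)))))) t := by
    intro t
    have he : HasDerivAt (fun t => Real.exp (2 * l * t)) (Real.exp (2 * l * t) * (2 * l)) t := by
      have : HasDerivAt (fun t : ℝ => 2 * l * t) (2 * l) t := by
        simpa using (hasDerivAt_id t).const_mul (2 * l)
      exact this.exp
    refine (he.mul (hquad t)).congr_deriv ?_
    ring
  have hanti : Antitone q := by
    refine antitone_of_deriv_nonpos (fun t => (hqd t).differentiableAt) fun t => ?_
    rw [(hqd t).deriv]
    refine mul_nonpos_of_nonneg_of_nonpos (Real.exp_pos _).le ?_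
    have h1 := hM (S t)
    have h2 : l * (S t ⬝ᵥ (P *ᵥ S t)) ≤ l * (b * ‖S t‖ ^ 2) := by gcongr; exact hb _
    have h3 : l * (b * ‖S t‖ ^ 2) = a * ‖S t‖ ^ 2 := by rw [hl]; field_simp
    linarith
  have h0 : q t ≤ q 0 := hanti ht
  have hS0 : S 0 = x := by simp [hS, Sg_zero]
  simp only [hq, mul_zero, Real.exp_zero, one_mul, hS0] at h0
  have h1 : p * ‖S t‖ ^ 2 ≤ b * ‖x‖ ^ 2 * Real.exp (-l * t) ^ 2 := by
    have e : Real.exp (2 * l * t) * Real.exp (-l * t) ^ 2 = 1 := by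
      rw [sq, ← Real.exp_add, ← Real.exp_add]; ring_nf; exact Real.exp_zero
    have h2 := (h0.trans (hb x))
    calc p * ‖S t‖ ^ 2 ≤ (S t ⬝ᵥ (P *ᵥ S t)) := hp _
      _ = (Real.exp (2 * l * t) * (S t ⬝ᵥ (P *ᵥ S t))) * Real.exp (-l * t) ^ 2 := by
          linear_combination (-(S t ⬝ᵥ (P *ᵥ S t))) * e
      _ ≤ _ := by gcongr
  have h2 : ‖S t‖ ^ 2 ≤ (Real.sqrt (b / p) * Real.exp (-l * t) * ‖x‖) ^ 2 := by
    rw [mul_pow, mul_pow, Real.sq_sqrt (by positivity)]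
    have : b / p * Real.exp (-l * t) ^ 2 * ‖x‖ ^ 2 = b * ‖x‖ ^ 2 * Real.exp (-l * t) ^ 2 / p := by
      ring
    rw [this, le_div_iff₀ hp0]
    linarith
  exact le_of_sq_le_sq h2 (by positivity)

end Energy

end RangeEq

namespace RangeEq

set_option linter.unusedSectionVars false

open MeasureTheory Topology Matrix
open scoped Pointwise

section Torus

variable {d m : ℕ}

/-- The covering map of the torus. -/
def cov (d : ℕ) : (Fin d → ℝ) →+ UnitAddTorus (Fin d) where
  toFun ψ := fun j => ((ψ j / (2 * π) : ℝ) : UnitAddCircle)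
  map_zero' := by ext j; simp
  map_add' x y := by
    ext j
    simp only [Pi.add_apply, add_div, AddCircle.coe_add]

lemma cov_apply (ψ : Fin d → ℝ) (j : Fin d) :
    cov d ψ j = ((ψ j / (2 * π) : ℝ) : UnitAddCircle) := rfl

lemma cov_open : IsOpenQuotientMap (cov d) := by
  have h1 : IsOpenQuotientMap (fun x : ℝ => ((x / (2 * π) : ℝ) : UnitAddCircle)) := by
    have h2 : IsOpenQuotientMap (fun x : ℝ => x * (2 * π)⁻¹) :=
      (Homeomorph.mulRight₀ ((2 * π)⁻¹ : ℝ) (by positivity)).isOpenQuotientMap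
    exact (QuotientAddGroup.isOpenQuotientMap_mk).comp h2
  exact IsOpenQuotientMap.piMap fun _ : Fin d => h1

lemma cov_eq {x y : Fin d → ℝ} (h : cov d x = cov d y) :
    ∃ k : Fin d → ℤ, x = fun j => y j + 2 * π * k j := by
  have h1 : ∀ j, ∃ n : ℤ, x j = y j + 2 * π * n := by
    intro j
    have h2 : cov d (x - y) j = 0 := by rw [map_sub, h, sub_self]; rfl
    rw [cov_apply, AddCircle.coe_eq_zero_iff] at h2
    obtain ⟨n, hn⟩ := h2
    refine ⟨n, ?_⟩
    rw [Pi.sub_apply, zsmul_eq_mul, mul_one] at hn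
    rw [hn]; field_simp; ring
  choose k hk using h1
  exact ⟨k, funext hk⟩

lemma cov_periodic (x : Fin d → ℝ) (k : Fin d → ℤ) :
    cov d (fun j => x j + 2 * π * k j) = cov d x := by
  ext j
  rw [cov_apply, cov_apply, ← sub_eq_zero, ← AddCircle.coe_sub, AddCircle.coe_eq_zero_iff]
  refine ⟨k j, ?_⟩
  rw [zsmul_eq_mul, mul_one]; field_simp; ring

/-- Haar measure on the torus -/
def haarT (d : ℕ) : Measure (UnitAddTorus (Fin d)) :=
  Measure.pi fun _ : Fin d => (volume : Measure UnitAddCircle)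

instance haarT_prob : IsProbabilityMeasure (haarT d) := by
  have : IsProbabilityMeasure (volume : Measure UnitAddCircle) :=
    ⟨by rw [UnitAddCircle.measure_univ]⟩
  unfold haarT; infer_instance

instance haarT_inv : (haarT d).IsAddRightInvariant := by
  unfold haarT; infer_instance

lemma haarT_integrable (U : C(UnitAddTorus (Fin d), Fin m → ℝ)) : Integrable U (haarT d) :=
  U.continuous.integrable_of_hasCompactSupport (HasCompactSupport.of_compactSpace _)

/-- mean on the torus -/
def meanT (d m : ℕ) : C(UnitAddTorus (Fin d), Fin m → ℝ) →L[ℝ] (Fin m → ℝ) :=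
  LinearMap.mkContinuous
    { toFun := fun U => ∫ x, U x ∂(haarT d)
      map_add' := fun U V => integral_add (haarT_integrable U) (haarT_integrable V)
      map_smul' := fun a U => integral_smul a U } 1 (by
    intro U
    rw [one_mul]
    refine (norm_integral_le_of_norm_le_const (C := ‖U‖)
      (Eventually.of_forall fun x => U.norm_coe_le_norm x)).trans ?_
    simp)

lemma meanT_apply (U : C(UnitAddTorus (Fin d), Fin m → ℝ)) :
    meanT d m U = ∫ x, U x ∂(haarT d) := rfl

lemma meanT_inv (L : (Fin m → ℝ) →L[ℝ] (Fin m → ℝ)) (a : UnitAddTorus (Fin d))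
    (h : C(UnitAddTorus (Fin d), Fin m → ℝ)) : meanT d m (pw L (tr a h)) = L (meanT d m h) := by
  rw [meanT_apply, meanT_apply]
  simp only [pw_apply, tr_apply]
  rw [integral_add_right_eq_self (μ := haarT d) (fun x => L (h x)) a]
  exact L.integral_comp_comm (haarT_integrable h)

lemma meanT_cst (v : Fin m → ℝ) : meanT d m (cst v) = v := by
  rw [meanT_apply]; simp

lemma boxMean_eq (U : C(UnitAddTorus (Fin d), Fin m → ℝ)) :
    boxMean d m (fun ψ => U (cov d ψ)) = meanT d m U := by
  have hmk : MeasurePreserving (fun (a : Fin d → ℝ) i => ((a i : ℝ) : UnitAddCircle))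
      (Measure.pi fun _ : Fin d => (volume : Measure ℝ).restrict (Set.Ioc 0 (0 + 1)))
      (haarT d) :=
    measurePreserving_pi _ _ fun i => AddCircle.measurePreserving_mk 1 0
  have h1 : meanT d m U = ∫ x in Set.univ.pi fun _ : Fin d => Set.Ioc (0 : ℝ) 1,
      U (fun i => ((x i : ℝ) : UnitAddCircle)) := by
    rw [meanT_apply, ← hmk.map_eq, integral_map hmk.measurable.aemeasurable
      U.continuous.aestronglyMeasurable, ← Measure.restrict_pi_pi, zero_add]
    rfl
  have h2 : (∫ ψ in Set.univ.pi fun _ : Fin d => Set.Icc (0 : ℝ) (2 * π), U (cov d ψ))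
      = ∫ ψ in Set.univ.pi fun _ : Fin d => Set.Ioc (0 : ℝ) (2 * π), U (cov d ψ) := by
    refine setIntegral_congr_set ?_
    rw [Set.pi_univ_Icc]
    exact (Measure.univ_pi_Ioc_ae_eq_Icc (μ := fun _ : Fin d => (volume : Measure ℝ))).symm
  have hpos : (0 : ℝ) < (2 * π)⁻¹ := by positivity
  have h3 := Measure.setIntegral_comp_smul_of_pos (volume : Measure (Fin d → ℝ))
    (fun x => U (fun i => ((x i : ℝ) : UnitAddCircle)))
    (Set.univ.pi fun _ : Fin d => Set.Ioc (0 : ℝ) (2 * π)) hpos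
  have h4 : (2 * π)⁻¹ • (Set.univ.pi fun _ : Fin d => Set.Ioc (0 : ℝ) (2 * π))
      = Set.univ.pi fun _ : Fin d => Set.Ioc (0 : ℝ) 1 := by
    ext x
    rw [Set.mem_smul_set_iff_inv_smul_mem₀ hpos.ne']
    simp only [Set.mem_univ_pi, inv_inv, Pi.smul_apply, smul_eq_mul, Set.mem_Ioc]
    refine forall_congr' fun i => ?_
    have hp : (0 : ℝ) < 2 * π := by positivity
    constructor
    · rintro ⟨a, b⟩
      exact ⟨by simpa [hp] using a, by simpa using (mul_le_iff_le_one_right hp).1 b⟩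
    · rintro ⟨a, b⟩
      exact ⟨by positivity, (mul_le_iff_le_one_right hp).2 b⟩
  have h5 : (∫ ψ in Set.univ.pi fun _ : Fin d => Set.Ioc (0 : ℝ) (2 * π), U (cov d ψ))
      = ∫ x in Set.univ.pi fun _ : Fin d => Set.Ioc (0 : ℝ) (2 * π),
        U (fun i => ((((2 * π)⁻¹ • x) i : ℝ) : UnitAddCircle)) := by
    congr 1
    ext1 x
    congr 1
    ext i
    rw [cov_apply, Pi.smul_apply, smul_eq_mul, div_eq_inv_mul]
  rw [boxMean, h2, h5, h3, h4, ← h1, smul_smul, Module.finrank_fin_fun, mul_inv_cancel₀, one_smul]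
  positivity

lemma fderiv_of_HD (ω : Fin d → ℝ) (θ : ℝ →+ UnitAddTorus (Fin d))
    (hθ : ∀ s, θ s = cov d (s • ω)) (U U1 : C(UnitAddTorus (Fin d), Fin m → ℝ)) (h : HD θ U U1)
    (hU : AnalyticOnNhd ℝ (fun y => U (cov d y)) Set.univ) (ψ : Fin d → ℝ) :
    fderiv ℝ (fun y => U (cov d y)) ψ ω = U1 (cov d ψ) := by
  have h1 := h (cov d ψ) 0
  have hl : HasDerivAt (fun s : ℝ => ψ + s • ω) ω 0 := by
    simpa using ((hasDerivAt_id (0 : ℝ)).smul_const ω).const_add ψ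
  have h2 : HasFDerivAt (fun y => U (cov d y)) (fderiv ℝ (fun y => U (cov d y)) ψ)
      (ψ + (0 : ℝ) • ω) := by
    rw [zero_smul, add_zero]
    exact (hU ψ (Set.mem_univ _)).differentiableAt.hasFDerivAt
  have h3 := h2.comp_hasDerivAt (0 : ℝ) hl
  have e : (fun s => U (cov d ψ + θ s)) = ((fun y => U (cov d y)) ∘ fun s : ℝ => ψ + s • ω) := by
    ext1 s; simp [hθ]
  rw [e, map_zero, add_zero] at h1
  exact h3.unique h1

end Torus

end RangeEq

open RangeEq

theorem range_equation_solution
    (m d : ℕ) (hm : 1 ≤ m) (hd : 1 ≤ d)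
    (ω : Fin d → ℝ) (hω : ∀ ν : Fin d → ℤ, ν ≠ 0 → (∑ j, ω j * ν j) ≠ 0)
    (Γ : Matrix (Fin m) (Fin m) ℝ) (hΓsymm : Γ.IsSymm) (hΓpos : Γ.PosDef)
    (V : (Fin m → ℝ) → ℝ) (hV : AnalyticOnNhd ℝ V Set.univ)
    (g : (Fin m → ℝ) → (Fin m → ℝ))
    (hg : ∀ x i, g x i = fderiv ℝ V x (Pi.single i 1))
    (f : (Fin d → ℝ) → (Fin m → ℝ))
    (hfper : IsPeriodic2pi d m f) (hfan : AnalyticOnNhd ℝ f Set.univ)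
    (c : Fin m → ℝ) (hc : g c = boxMean d m f)
    (hhess : (hessianMatrix m V c).PosDef) :
    ∃ εbar > (0 : ℝ), ∃ ζbar > (0 : ℝ),
      ∀ ε ∈ Set.Ioo (0 : ℝ) εbar, ∀ ζ : Fin m → ℝ, ‖ζ‖ < ζbar →
        ∃ u : (Fin d → ℝ) → (Fin m → ℝ),
          AnalyticOnNhd ℝ u Set.univ ∧ IsPeriodic2pi d m u ∧
          boxMean d m u = 0 ∧
          ∀ ψ : Fin d → ℝ,
            ε • fderiv ℝ (fun φ : Fin d → ℝ => fderiv ℝ u φ ω) ψ ω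
              + Γ.mulVec (fderiv ℝ u ψ ω)
              + ε • (g (c + ζ + u ψ) - boxMean d m fun φ => g (c + ζ + u φ))
            = ε • (f ψ - boxMean d m f) := by
  -- the nonlinearity
  set Lg : ((Fin m → ℝ) →L[ℝ] ℝ) →L[ℝ] (Fin m → ℝ) :=
    ContinuousLinearMap.pi fun i => ContinuousLinearMap.apply ℝ ℝ (Pi.single i (1 : ℝ)) with hLg
  have hgL : g = fun x => Lg (fderiv ℝ V x) := by
    ext x i; rw [hg]; rfl
  have hgan : AnalyticOnNhd ℝ g Set.univ := by
    rw [hgL]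
    intro x hx
    exact (Lg.analyticAt _).comp (hV.fderiv x hx)
  have hgcont : Continuous g := by
    rw [← continuousOn_univ]; exact hgan.continuousOn
  set H := hessianMatrix m V c with hH
  have hHsymm : ∀ i j, H i j = H j i := by
    intro i j
    have := hhess.isHermitian.apply j i
    simpa using this
  set A := fderiv ℝ g c with hA
  have hAH : ∀ v, A v = H.mulVec v := by
    intro v
    have h1 : A v = Lg (fderiv ℝ (fderiv ℝ V) c v) := by
      rw [hA, hgL]
      have hd2 := (hV.fderiv c (Set.mem_univ _)).differentiableAt.hasFDerivAt
      have hd3 : HasFDerivAt (fun x => Lg (fderiv ℝ V x)) (Lg.comp (fderiv ℝ (fderiv ℝ V) c)) c :=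
        Lg.hasFDerivAt.comp c hd2
      rw [hd3.fderiv]; rfl
    rw [h1]
    ext i
    change fderiv ℝ (fderiv ℝ V) c v (Pi.single i 1) = ∑ j, H i j * v j
    conv_lhs => rw [pi_eq_sum_univ' v]
    rw [map_sum, _root_.sum_apply]
    refine Finset.sum_congr rfl fun j _ => ?_
    rw [hHsymm i j, hH]
    simp only [hessianMatrix, Matrix.of_apply, iteratedFDeriv_two_apply]
    rw [map_smul]
    simp [mul_comm]
  set Γc : (Fin m → ℝ) →L[ℝ] (Fin m → ℝ) := LinearMap.toContinuousLinearMap Γ.mulVecLin with hΓc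
  set B : (Fin m → ℝ) →L[ℝ] (Fin m → ℝ) :=
    LinearMap.toContinuousLinearMap (Γ⁻¹ * H).mulVecLin with hB
  have hΓa : ∀ v, Γc v = Γ.mulVec v := fun v => rfl
  have hBa : ∀ v, B v = (Γ⁻¹ * H).mulVec v := fun v => rfl
  have hΓB : ∀ v, Γc (B v) = A v := by
    intro v
    rw [hΓa, hBa, Matrix.mulVec_mulVec, ← mul_assoc, Matrix.mul_nonsing_inv _
      ((Matrix.isUnit_iff_isUnit_det _).1 hΓpos.isUnit), one_mul, hAH]
  obtain ⟨a₁, ha₁, h₁⟩ := posDef_lower Γ hΓpos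
  obtain ⟨C₁, l₁, hl₁, hD₁⟩ := energy_decay 1 Matrix.PosDef.one Γc a₁ ha₁ (by
    intro x; rw [Matrix.one_mulVec]; exact h₁ x)
  obtain ⟨a₂, ha₂, h₂⟩ := posDef_lower H hhess
  obtain ⟨C₂, l₂, hl₂, hD₂⟩ := energy_decay Γ hΓpos B a₂ ha₂ (by
    intro x; rw [← hΓa, hΓB, hAH]; exact h₂ x)
  -- the forcing
  have hfcont : Continuous f := by
    rw [← continuousOn_univ]; exact hfan.continuousOn
  obtain ⟨fT, hfT⟩ : ∃ fT : C(UnitAddTorus (Fin d), Fin m → ℝ), ∀ ψ, fT (cov d ψ) = f ψ := by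
    have hs := (cov_open (d := d)).surjective
    have hfac : ∀ y, f (Function.surjInv hs (cov d y)) = f y := by
      intro y
      obtain ⟨k, hk⟩ := cov_eq (Function.surjInv_eq hs (cov d y))
      rw [hk]; exact hfper y k
    refine ⟨⟨fun a => f (Function.surjInv hs a), ?_⟩, hfac⟩
    rw [(cov_open (d := d)).isQuotientMap.continuous_iff]
    exact hfcont.congr fun y => (hfac y).symm
  have hfT' : (fun y => fT (cov d y)) = f := funext hfT
  -- the flow
  let θ : ℝ →+ UnitAddTorus (Fin d) :=
    (cov d).comp ((LinearMap.toSpanSingleton ℝ (Fin d → ℝ) ω).toAddMonoidHom)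
  have hθ : ∀ s, θ s = cov d (s • ω) := fun s => rfl
  have hθc : Continuous θ :=
    (cov_open (d := d)).continuous.comp (continuous_id.smul continuous_const)
  have hμtr : ∀ a h, meanT d m (tr a h) = meanT d m h := fun a h =>
    meanT_inv (ContinuousLinearMap.id ℝ _) a h
  obtain ⟨εbar, hε, ζbar, hζ, hmain⟩ := abstract_main (cov d) cov_open θ hθc (meanT d m)
    meanT_inv meanT_cst Γc A B hΓB hD₁ hl₁ hD₂ hl₂ g hgcont c (hgan c (Set.mem_univ _)) rfl fT
    (by rw [hfT']; exact hfan)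
    (fun δ hδ => dense_main ω hω θ hθc (fun s j => rfl) (meanT d m) hμtr meanT_cst fT δ hδ)
  refine ⟨εbar, hε, ζbar, hζ, fun ε hε' ζ hζ' => ?_⟩
  obtain ⟨U, U1, U2, hUan, hU0, hU1, hU2, heq⟩ := hmain ε hε' ζ hζ'
  have e1 : ∀ ψ, fderiv ℝ (fun y => U (cov d y)) ψ ω = U1 (cov d ψ) :=
    fderiv_of_HD ω θ hθ U U1 hU1 hUan
  have hU1an : AnalyticOnNhd ℝ (fun y => U1 (cov d y)) Set.univ := by
    have : (fun y => U1 (cov d y)) = fun y =>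
        (ContinuousLinearMap.apply ℝ (Fin m → ℝ) ω) (fderiv ℝ (fun y => U (cov d y)) y) := by
      ext1 y; rw [← e1]; rfl
    rw [this]
    intro y hy
    exact ((ContinuousLinearMap.apply ℝ (Fin m → ℝ) ω).analyticAt _).comp (hUan.fderiv y hy)
  have e2 : ∀ ψ, fderiv ℝ (fun y => U1 (cov d y)) ψ ω = U2 (cov d ψ) :=
    fderiv_of_HD ω θ hθ U1 U2 hU2 hU1an
  refine ⟨fun y => U (cov d y), hUan, fun ψ k => ?_, ?_, fun ψ => ?_⟩
  · simp only [cov_periodic]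
  · rw [boxMean_eq, hU0]
  · have e3 : (fun φ : Fin d → ℝ => fderiv ℝ (fun y => U (cov d y)) φ ω)
        = fun y => U1 (cov d y) := funext e1
    rw [e3, e2, e1]
    have e4 : boxMean d m f = meanT d m fT := by rw [← boxMean_eq, hfT']
    have e5 : (boxMean d m fun φ => g (c + ζ + U (cov d φ)))
        = meanT d m (post (fun v => g (c + ζ + v)) (by fun_prop) U) := by
      rw [← boxMean_eq]; rfl
    rw [e4, e5, ← hfT ψ]
    exact heq (cov d ψ)

end
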